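/- arXiv:1606.05950 — 5 statements merged into one kernel-verified Lean document; each statement's English description precedes it below -/
import Mathlib

section
/- Let G be a bicyclic graph of order 6 that is not isomorphic to any of B(6,0), B(6,1), B_6^{(1)}, B_6^{3,3}. Then W(G) < W(B_6^{(1)}) < W(B(6,1)) = W(B_6^{3,3}) < W(B(6,0)). -/
open SimpleGraph Finset
open scoped Classical

noncomputable section

/-- The Wiener index of a graph, as a rational number: half of the sum of
distances over all ordered pairs of vertices (i.e. the sum over unordered pairs). -/
def wienerIndex {V : Type*} [Fintype V] (G : SimpleGraph V) : ℚ :=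
  (∑ u : V, ∑ v : V, (G.dist u v : ℚ)) / 2

/-- The transmission `D_G(v)` of a vertex: the sum of distances to all vertices. -/
def transmission {V : Type*} [Fintype V] (G : SimpleGraph V) (v : V) : ℚ :=
  ∑ x : V, (G.dist x v : ℚ)

/-- `n_u(e)` for `e = uv`: the number of vertices strictly closer to `u` than to `v`. -/
def nCloser {V : Type*} [Fintype V] (G : SimpleGraph V) (u v : V) : ℕ :=
  (Finset.univ.filter fun w => G.dist u w < G.dist v w).card

/-- `n_0(e)` for `e = uv`: the number of vertices equidistant from `u` and `v`. -/
def nEqual {V : Type*} [Fintype V] (G : SimpleGraph V) (u v : V) : ℕ :=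
  (Finset.univ.filter fun w => G.dist u w = G.dist v w).card

/-- The Szeged index, as a rational number (each edge is counted once). -/
def szeged {V : Type*} [Fintype V] (G : SimpleGraph V) : ℚ :=
  (∑ u : V, ∑ v : V,
    if G.Adj u v then (nCloser G u v : ℚ) * (nCloser G v u : ℚ) else 0) / 2

/-- The revised Szeged index, as a rational number (each edge is counted once). -/
def szegedStar {V : Type*} [Fintype V] (G : SimpleGraph V) : ℚ :=
  (∑ u : V, ∑ v : V,
    if G.Adj u v then
      ((nCloser G u v : ℚ) + (nEqual G u v : ℚ) / 2) *
        ((nCloser G v u : ℚ) + (nEqual G u v : ℚ) / 2)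
    else 0) / 2

/-- The cycle `C_k` on the vertices `0, 1, …, k-1`. -/
def cycleG (k : ℕ) : SimpleGraph (Fin k) :=
  SimpleGraph.fromRel (fun a b => a.val + 1 = b.val ∨ (a.val = 0 ∧ b.val = k - 1))

/-- The lollipop `L_{n,r}`: the cycle `C_r` on `0, …, r-1` together with the
path `r-1, r, …, n-1` attached at the cycle vertex `r-1`. -/
def lollipop (n r : ℕ) : SimpleGraph (Fin n) :=
  SimpleGraph.fromRel (fun a b => a.val + 1 = b.val ∨ (a.val = 0 ∧ b.val = r - 1))

/-- `H_n^0`: a triangle `0,1,2`, a path `2, 3, …, n-3` (so `u_1 = 2`, `u_{n-4} = n-3`)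
and two pendant vertices `n-2, n-1` attached at `n-3`. -/
def Hgraph0 (n : ℕ) : SimpleGraph (Fin n) :=
  SimpleGraph.fromRel (fun a b =>
    (a.val + 1 = b.val ∧ b.val ≤ n - 2) ∨ (a.val = 0 ∧ b.val = 2) ∨
    (a.val = n - 3 ∧ b.val = n - 1))

/-- `H_n^1`: a triangle `0,1,2`, a path `2, 3, …, n-4` (so `u_1 = 2`, `u_{n-5} = n-4`),
a path of length two `n-4, n-3, n-2` and a pendant vertex `n-1` attached at `n-4`. -/
def Hgraph1 (n : ℕ) : SimpleGraph (Fin n) :=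
  SimpleGraph.fromRel (fun a b =>
    (a.val + 1 = b.val ∧ b.val ≤ n - 2) ∨ (a.val = 0 ∧ b.val = 2) ∨
    (a.val = n - 4 ∧ b.val = n - 1))

/-- `H_n^2`: a `4`-cycle `0,1,2,3`, a path `3, 4, …, n-3` (so `u_1 = 3`, `u_{n-5} = n-3`)
and two pendant vertices `n-2, n-1` attached at `n-3`. -/
def Hgraph2 (n : ℕ) : SimpleGraph (Fin n) :=
  SimpleGraph.fromRel (fun a b =>
    (a.val + 1 = b.val ∧ b.val ≤ n - 2) ∨ (a.val = 0 ∧ b.val = 3) ∨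
    (a.val = n - 3 ∧ b.val = n - 1))

/-- `H_n^3`: a triangle `0,1,2`, a path `2, 3, …, n-4` (so `u_1 = 2`, `u_{n-5} = n-4`),
two pendant vertices `n-3, n-2` attached at `n-4`, and a pendant vertex `n-1`
attached at the second triangle vertex `0`. -/
def Hgraph3 (n : ℕ) : SimpleGraph (Fin n) :=
  SimpleGraph.fromRel (fun a b =>
    (a.val + 1 = b.val ∧ b.val ≤ n - 3) ∨ (a.val = 0 ∧ b.val = 2) ∨
    (a.val = n - 4 ∧ b.val = n - 2) ∨ (a.val = 0 ∧ b.val = n - 1))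

/-- `B(n,s)`: `K_4^-` on the vertices `x = n-s-4`, `u = n-s-3`, `y = n-s-2`, `v = n-1`
(with the edge `xy` missing), a path on `n-s-4` vertices `0, …, n-s-5` attached at `x`,
and a path on `s` vertices `n-s-1, …, n-2` attached at `y`. -/
def Bgraph (n s : ℕ) : SimpleGraph (Fin n) :=
  SimpleGraph.fromRel (fun a b =>
    (a.val + 1 = b.val ∧ b.val ≤ n - 2) ∨
    (b.val = n - 1 ∧ (a.val = n - s - 4 ∨ a.val = n - s - 3 ∨ a.val = n - s - 2)))

/-- `B_n^{(1)}`: `K_4^-` on the vertices `n-4, n-3, n-2, n-1` (with the edge between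
`n-2` and `n-1` missing), with an end-vertex of the path `0, 1, …, n-4` identified with
the degree-`3` vertex `n-4` of `K_4^-`. -/
def Bn1 (n : ℕ) : SimpleGraph (Fin n) :=
  SimpleGraph.fromRel (fun a b =>
    (a.val + 1 = b.val ∧ b.val ≤ n - 3) ∨
    (a.val = n - 4 ∧ b.val = n - 2) ∨ (a.val = n - 4 ∧ b.val = n - 1) ∨
    (a.val = n - 3 ∧ b.val = n - 2) ∨ (a.val = n - 3 ∧ b.val = n - 1))

/-- `B_n^{3,3}`: two triangles `0,1,2` and `n-3,n-2,n-1` joined by the path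
`2, 3, …, n-3` of length `n-5`. -/
def B33 (n : ℕ) : SimpleGraph (Fin n) :=
  SimpleGraph.fromRel (fun a b =>
    a.val + 1 = b.val ∨ (a.val = 0 ∧ b.val = 2) ∨ (a.val = n - 3 ∧ b.val = n - 1))

/-- `C_r(P_{m 0 + 1}, …, P_{m (r-1) + 1})`: the unicyclic graph obtained from the cycle
`C_r` by identifying, for each `i`, one end-vertex of a path on `m i + 1` vertices with
the `i`-th cycle vertex.  The vertex `⟨i, 0⟩` is the cycle vertex `v_i`, and `⟨i, j⟩`
for `j ≥ 1` are the remaining vertices of the path attached at `v_i`. -/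
def cyclePaths (r : ℕ) (m : Fin r → ℕ) : SimpleGraph (Σ i : Fin r, Fin (m i + 1)) :=
  SimpleGraph.fromRel (fun a b =>
    (a.2.val = 0 ∧ b.2.val = 0 ∧ (a.1.val + 1) % r = b.1.val) ∨
    (a.1 = b.1 ∧ a.2.val + 1 = b.2.val))

/-- The graph obtained from vertex-disjoint graphs `G₁`, `G₂` by identifying the
vertex `v₁` of `G₁` with the vertex `v₂` of `G₂`; the common vertex is `Sum.inl v₁`. -/
def glue {V₁ V₂ : Type*} (G₁ : SimpleGraph V₁) (G₂ : SimpleGraph V₂) (v₁ : V₁) (v₂ : V₂) :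
    SimpleGraph (V₁ ⊕ {x : V₂ // x ≠ v₂}) :=
  SimpleGraph.fromRel (fun a b =>
    match a, b with
    | Sum.inl a, Sum.inl b => G₁.Adj a b
    | Sum.inr a, Sum.inr b => G₂.Adj a.val b.val
    | Sum.inl a, Sum.inr b => a = v₁ ∧ G₂.Adj v₂ b.val
    | Sum.inr _, Sum.inl _ => False)

/-- The spider `A_{n,4}`: a center `n-5` with one leg `n-5, n-6, …, 0` of length
`n-5` and four legs of length one ending at the unit leaves `n-4, n-3, n-2, n-1`;
the non-unit leaf is the vertex `0`. -/
def spiderA (n : ℕ) : SimpleGraph (Fin n) :=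
  SimpleGraph.fromRel (fun a b =>
    (a.val + 1 = b.val ∧ b.val ≤ n - 5) ∨ (a.val = n - 5 ∧ n - 4 ≤ b.val))

/-- The theta graph `B_{k,l,t}` on `k + l + t - 1` vertices: the vertices `u = 0` and
`w = k` joined by three internally disjoint paths of lengths `k`, `l`, `t`, with
internal vertices `1, …, k-1`, `k+1, …, k+l-1` and `k+l, …, k+l+t-2` respectively. -/
def theta (k l t : ℕ) : SimpleGraph (Fin (k + l + t - 1)) :=
  SimpleGraph.fromRel (fun a b =>
    (a.val + 1 = b.val ∧ b.val ≤ k) ∨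
    (a.val = 0 ∧ b.val = k + 1) ∨
    (a.val + 1 = b.val ∧ k + 1 ≤ a.val ∧ b.val ≤ k + l - 1) ∨
    (a.val = k ∧ b.val = k + l - 1) ∨
    (a.val = 0 ∧ b.val = k + l) ∨
    (a.val + 1 = b.val ∧ k + l ≤ a.val ∧ b.val ≤ k + l + t - 2) ∨
    (a.val = k ∧ b.val = k + l + t - 2))

/-- A set of vertices `B` induces a subgraph with no cut vertex. -/
def NoCutVtx {V : Type*} (G : SimpleGraph V) (B : Set V) : Prop :=
  ∀ v ∈ B, (G.induce (B \ {v})).Preconnected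

/-- `B` is (the vertex set of) a block of `G`: a maximal connected subgraph of `G`
without a cut vertex. -/
def IsBlock {V : Type*} (G : SimpleGraph V) (B : Set V) : Prop :=
  (G.induce B).Connected ∧ NoCutVtx G B ∧
  ∀ C : Set V, B ⊆ C → (G.induce C).Connected → NoCutVtx G C → C = B

/-- A table `D` in which entries grow by at most one along edges is a lower bound for
the graph distance. -/
theorem le_dist_of_table {V : Type*} {G : SimpleGraph V} (hconn : G.Connected)
    {D : V → V → ℕ} (hzero : ∀ u, D u u = 0)
    (hstep : ∀ u v w, G.Adj v w → D u w ≤ D u v + 1) (u v : V) :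
    D u v ≤ G.dist u v := by
  have hwalk : ∀ (a b : V) (p : G.Walk a b), D u b ≤ D u a + p.length := by
    intro a b p
    induction p with
    | nil => simp
    | cons h p ih =>
      have := hstep u _ _ h
      rw [Walk.length_cons]
      omega
  obtain ⟨p, hp⟩ := hconn.exists_walk_length_eq_dist u v
  simpa [hzero, hp] using hwalk u v p

/-- Boolean disjunction over `Fin 6`, written out so that the kernel evaluates it quickly. -/
def anyFin (f : Fin 6 → Bool) : Bool := f 0 || f 1 || f 2 || f 3 || f 4 || f 5

/-- Boolean conjunction over `Fin 6`, written out so that the kernel evaluates it quickly. -/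
def allFin (f : Fin 6 → Bool) : Bool := f 0 && f 1 && f 2 && f 3 && f 4 && f 5

/-- Summation over `Fin 6`, written out so that the kernel evaluates it quickly. -/
def sumFin (f : Fin 6 → ℕ) : ℕ := f 0 + f 1 + f 2 + f 3 + f 4 + f 5

theorem anyFin_iff (f : Fin 6 → Bool) : anyFin f ↔ ∃ i, f i := by
  simp [anyFin, Fin.exists_fin_succ, or_assoc]

theorem allFin_iff (f : Fin 6 → Bool) : allFin f ↔ ∀ i, f i := by
  simp [allFin, Fin.forall_fin_succ, and_assoc]

theorem sumFin_eq_sum (f : Fin 6 → ℕ) : sumFin f = ∑ i, f i := (Fin.sum_univ_six f).symm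

/-- Whether the graph with adjacency matrix `A` has a walk of length `k` from `u` to `v`. -/
def hasWalk (A : Fin 6 → Fin 6 → Bool) : ℕ → Fin 6 → Fin 6 → Bool
  | 0, u, v => u.val == v.val
  | k + 1, u, v => anyFin fun w => A u w && hasWalk A k w v

/-- The table of distances of the graph with adjacency matrix `A`, with `100` in place of
distances greater than `4`. -/
def distTable (A : Fin 6 → Fin 6 → Bool) (u v : Fin 6) : ℕ :=
  bif hasWalk A 0 u v then 0
  else bif A u v then 1
  else bif hasWalk A 2 u v then 2
  else bif hasWalk A 3 u v then 3
  else bif hasWalk A 4 u v then 4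
  else 100

/-- The sum of all entries of `distTable A`. -/
def distTableSum (A : Fin 6 → Fin 6 → Bool) : ℕ := sumFin fun u => sumFin fun v => distTable A u v

/-- The entries of `distTable A` grow by at most one along edges. -/
def distTableStep (A : Fin 6 → Fin 6 → Bool) : Bool :=
  allFin fun v => allFin fun w => !A v w ||
    allFin fun u => (distTable A u w).ble (distTable A u v + 1)

theorem distTableSum_eq_sum (A : Fin 6 → Fin 6 → Bool) :
    distTableSum A = ∑ u, ∑ v, distTable A u v := by
  simp only [distTableSum, sumFin_eq_sum]

theorem exists_walk_of_hasWalk {G : SimpleGraph (Fin 6)} {A : Fin 6 → Fin 6 → Bool}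
    (hA : ∀ i j, G.Adj i j ↔ A i j) {k : ℕ} {u v : Fin 6} (h : hasWalk A k u v) :
    ∃ p : G.Walk u v, p.length = k := by
  induction k generalizing u with
  | zero =>
    obtain rfl : u = v := Fin.ext (by simpa [hasWalk] using h)
    exact ⟨Walk.nil, rfl⟩
  | succ k ih =>
    rw [hasWalk, anyFin_iff] at h
    obtain ⟨w, hw⟩ := h
    rw [Bool.and_eq_true] at hw
    obtain ⟨p, rfl⟩ := ih hw.2
    exact ⟨Walk.cons ((hA u w).mpr hw.1) p, rfl⟩

theorem exists_walk_length_eq_distTable {G : SimpleGraph (Fin 6)} {A : Fin 6 → Fin 6 → Bool}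
    (hA : ∀ i j, G.Adj i j ↔ A i j) (hsum : distTableSum A < 100) (u v : Fin 6) :
    ∃ p : G.Walk u v, p.length = distTable A u v := by
  have hlt : distTable A u v < 100 := by
    refine lt_of_le_of_lt ?_ hsum
    rw [distTableSum_eq_sum]
    exact (Finset.single_le_sum (f := fun v => distTable A u v) (fun _ _ => Nat.zero_le _)
      (mem_univ v)).trans (Finset.single_le_sum (f := fun u => ∑ v, distTable A u v)
      (fun _ _ => Nat.zero_le _) (mem_univ u))
  unfold distTable at hlt ⊢
  cases h0 : hasWalk A 0 u v
  · cases h1 : A u v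
    · cases h2 : hasWalk A 2 u v
      · cases h3 : hasWalk A 3 u v
        · cases h4 : hasWalk A 4 u v
          · simp [h0, h1, h2, h3, h4] at hlt
          · exact exists_walk_of_hasWalk hA h4
        · exact exists_walk_of_hasWalk hA h3
      · exact exists_walk_of_hasWalk hA h2
    · exact ⟨((hA u v).mpr h1).toWalk, rfl⟩
  · exact exists_walk_of_hasWalk hA h0

theorem wienerIndex_le_distTableSum {G : SimpleGraph (Fin 6)} {A : Fin 6 → Fin 6 → Bool}
    (hA : ∀ i j, G.Adj i j ↔ A i j) (hsum : distTableSum A < 100) :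
    wienerIndex G ≤ (distTableSum A : ℚ) / 2 := by
  have h : ∀ u v, G.dist u v ≤ distTable A u v := fun u v => by
    obtain ⟨p, hp⟩ := exists_walk_length_eq_distTable hA hsum u v
    exact hp ▸ dist_le p
  rw [distTableSum_eq_sum]
  unfold wienerIndex
  push_cast
  gcongr
  exact h _ _

theorem wienerIndex_eq_distTableSum {G : SimpleGraph (Fin 6)} {A : Fin 6 → Fin 6 → Bool}
    (hA : ∀ i j, G.Adj i j ↔ A i j) (hsum : distTableSum A < 100) (hstep : distTableStep A) :
    wienerIndex G = (distTableSum A : ℚ) / 2 := by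
  have hconn : G.Connected :=
    ⟨fun u v => (exists_walk_length_eq_distTable hA hsum u v).choose.reachable⟩
  refine le_antisymm (wienerIndex_le_distTableSum hA hsum) ?_
  have hstep' : ∀ u v w, G.Adj v w → distTable A u w ≤ distTable A u v + 1 := by
    intro u v w hvw
    simp only [distTableStep, allFin_iff] at hstep
    have := hstep v w
    rw [(hA v w).mp hvw, Bool.not_true, Bool.false_or, allFin_iff] at this
    exact Nat.le_of_ble_eq_true (this u)
  have h : ∀ u v, distTable A u v ≤ G.dist u v :=
    le_dist_of_table hconn (by simp [distTable, hasWalk]) hstep'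
  rw [distTableSum_eq_sum]
  unfold wienerIndex
  push_cast
  gcongr
  exact h _ _

/-- The Boolean adjacency matrix of `SimpleGraph.fromRel r`. -/
def boolAdj (r : Fin 6 → Fin 6 → Bool) (i j : Fin 6) : Bool :=
  i.val != j.val && (r i j || r j i)

/-- The adjacency matrix of `Bgraph 6 s`. -/
def adjBgraph (s : ℕ) : Fin 6 → Fin 6 → Bool :=
  boolAdj fun a b => (a.val + 1 == b.val && b.val.ble 4) ||
    (b.val == 5 && (a.val == 6 - s - 4 || a.val == 6 - s - 3 || a.val == 6 - s - 2))

/-- The adjacency matrix of `Bn1 6`. -/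
def adjBn1 : Fin 6 → Fin 6 → Bool :=
  boolAdj fun a b => (a.val + 1 == b.val && b.val.ble 3) ||
    ((a.val == 2 || a.val == 3) && (b.val == 4 || b.val == 5))

/-- The adjacency matrix of `B33 6`. -/
def adjB33 : Fin 6 → Fin 6 → Bool :=
  boolAdj fun a b => a.val + 1 == b.val || (a.val == 0 && b.val == 2) ||
    (a.val == 3 && b.val == 5)

theorem Bgraph_adj (s : ℕ) (i j : Fin 6) : (Bgraph 6 s).Adj i j ↔ adjBgraph s i j := by
  simp [Bgraph, adjBgraph, boolAdj, Fin.ext_iff, or_assoc]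

theorem Bn1_adj (i j : Fin 6) : (Bn1 6).Adj i j ↔ adjBn1 i j := by
  simp only [Bn1, adjBn1, boolAdj, fromRel_adj, Nat.ble_eq, Bool.and_eq_true, Bool.or_eq_true]
  grind

theorem B33_adj (i j : Fin 6) : (B33 6).Adj i j ↔ adjB33 i j := by
  simp only [B33, adjB33, boolAdj, fromRel_adj]
  grind

theorem wienerIndex_Bgraph_zero : wienerIndex (Bgraph 6 0) = 28 := by
  have hsum : distTableSum (adjBgraph 0) = 56 := by decide +kernel
  rw [wienerIndex_eq_distTableSum (Bgraph_adj 0) (by simp [hsum]) (by decide +kernel), hsum]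
  norm_num

theorem wienerIndex_Bgraph_one : wienerIndex (Bgraph 6 1) = 27 := by
  have hsum : distTableSum (adjBgraph 1) = 54 := by decide +kernel
  rw [wienerIndex_eq_distTableSum (Bgraph_adj 1) (by simp [hsum]) (by decide +kernel), hsum]
  norm_num

theorem wienerIndex_Bn1 : wienerIndex (Bn1 6) = 26 := by
  have hsum : distTableSum adjBn1 = 52 := by decide +kernel
  rw [wienerIndex_eq_distTableSum Bn1_adj (by simp [hsum]) (by decide +kernel), hsum]
  norm_num

theorem wienerIndex_B33 : wienerIndex (B33 6) = 27 := by
  have hsum : distTableSum adjB33 = 54 := by decide +kernel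
  rw [wienerIndex_eq_distTableSum B33_adj (by simp [hsum]) (by decide +kernel), hsum]
  norm_num

theorem dist_map_le {V W : Type*} {G : SimpleGraph V} {H : SimpleGraph W} (f : G →g H)
    {u v : V} (huv : G.Reachable u v) : H.dist (f u) (f v) ≤ G.dist u v := by
  obtain ⟨p, hp⟩ := huv.exists_walk_length_eq_dist
  simpa [hp] using dist_le (p.map f)

theorem wienerIndex_congr {V W : Type*} [Fintype V] [Fintype W] {G : SimpleGraph V}
    {H : SimpleGraph W} (e : G ≃g H) (hconn : G.Connected) :
    wienerIndex G = wienerIndex H := by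
  have h : ∀ u v, G.dist u v = H.dist (e u) (e v) := fun u v => by
    refine le_antisymm ?_ (dist_map_le e.toHom (hconn u v))
    simpa using dist_map_le e.symm.toHom ((hconn u v).map e.toHom)
  unfold wienerIndex
  congr 1
  refine Fintype.sum_equiv e.toEquiv _ _ fun u => Fintype.sum_equiv e.toEquiv _ _ fun v => ?_
  simp [h]

/-- Sending `t` to `x` is consistent with the pairs `(s, y)` already matched, where `T` is the
matrix of the source and `A` that of the target. -/
def matchesAt (A T : Fin 6 → Fin 6 → Bool) (l : List (Fin 6 × Fin 6)) (t x : Fin 6) : Bool :=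
  l.all fun c => x.val != c.2.val && A c.2 x == T c.1 t

/-- The matrices `A` and `T` agree up to a relabelling, in a form suited to a backtracking
search. -/
def isRelabelling (A T : Fin 6 → Fin 6 → Bool) : Bool :=
  anyFin fun a => anyFin fun b => matchesAt A T [(0, a)] 1 b &&
  anyFin fun c => matchesAt A T [(0, a), (1, b)] 2 c &&
  anyFin fun d => matchesAt A T [(0, a), (1, b), (2, c)] 3 d &&
  anyFin fun e => matchesAt A T [(0, a), (1, b), (2, c), (3, d)] 4 e &&
  anyFin fun f => matchesAt A T [(0, a), (1, b), (2, c), (3, d), (4, e)] 5 f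

theorem nonempty_iso_of_isRelabelling {G H : SimpleGraph (Fin 6)} {A T : Fin 6 → Fin 6 → Bool}
    (hA : ∀ i j, G.Adj i j ↔ A i j) (hT : ∀ i j, H.Adj i j ↔ T i j)
    (h : isRelabelling A T) : Nonempty (G ≃g H) := by
  simp only [isRelabelling, anyFin_iff, Bool.and_eq_true] at h
  obtain ⟨a, b, hb, c, hc, d, hd, e, he, f, hf⟩ := h
  simp only [matchesAt, List.all_cons, List.all_nil, Bool.and_true, Bool.and_eq_true, bne_iff_ne,
    beq_iff_eq, ne_eq, Fin.val_inj] at hb hc hd he hf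
  have hlt : ∀ i j : Fin 6, i < j →
      (![a, b, c, d, e, f] i ≠ ![a, b, c, d, e, f] j ∧
        (H.Adj i j ↔ G.Adj (![a, b, c, d, e, f] i) (![a, b, c, d, e, f] j))) := by
    intro i j hij
    rw [hA, hT]
    fin_cases i <;> fin_cases j <;> first | exact absurd hij (by decide) | skip
    all_goals simp_all [ne_comm]
  have hinj : Function.Injective ![a, b, c, d, e, f] := by
    intro i j hij
    rcases lt_trichotomy i j with h | h | h
    · exact absurd hij (hlt i j h).1
    · exact h
    · exact absurd hij.symm (hlt j i h).1
  let σ : Fin 6 ≃ Fin 6 := Equiv.ofBijective _ (Finite.injective_iff_bijective.mp hinj)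
  refine ⟨(RelIso.symm ⟨σ, ?_⟩ : G ≃g H)⟩
  intro i j
  change G.Adj (![a, b, c, d, e, f] i) (![a, b, c, d, e, f] j) ↔ H.Adj i j
  rcases lt_trichotomy i j with h | h | h
  · exact (hlt i j h).2.symm
  · simp [h]
  · rw [G.adj_comm, H.adj_comm]
    exact (hlt j i h).2.symm

/-- The adjacency matrix of a graph in which `0, 1, 2, 3` is an induced path, with neighbours
of `4`, `5` given by `p`, `q` and the adjacency of `4` and `5` given by `r`. -/
def pathExtension (p₀ p₁ p₂ p₃ q₀ q₁ q₂ q₃ r : Bool) : Fin 6 → Fin 6 → Bool :=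
  ![![false, true, false, false, p₀, q₀],
    ![true, false, true, false, p₁, q₁],
    ![false, true, false, true, p₂, q₂],
    ![false, false, true, false, p₃, q₃],
    ![p₀, p₁, p₂, p₃, false, r],
    ![q₀, q₁, q₂, q₃, r, false]]

theorem pathExtension_cases : ∀ p₀ p₁ p₂ p₃ q₀ q₁ q₂ q₃ r : Bool,
    p₀.toNat + p₁.toNat + p₂.toNat + p₃.toNat + q₀.toNat + q₁.toNat + q₂.toNat + q₃.toNat
      + r.toNat = 4 →
    (p₀ || p₁ || p₂ || p₃ || r) = true → (q₀ || q₁ || q₂ || q₃ || r) = true →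
    distTableSum (pathExtension p₀ p₁ p₂ p₃ q₀ q₁ q₂ q₃ r) < 52 ∨
    isRelabelling (pathExtension p₀ p₁ p₂ p₃ q₀ q₁ q₂ q₃ r) (adjBgraph 0) ∨
    isRelabelling (pathExtension p₀ p₁ p₂ p₃ q₀ q₁ q₂ q₃ r) (adjBgraph 1) ∨
    isRelabelling (pathExtension p₀ p₁ p₂ p₃ q₀ q₁ q₂ q₃ r) adjBn1 ∨
    isRelabelling (pathExtension p₀ p₁ p₂ p₃ q₀ q₁ q₂ q₃ r) adjB33 := by
  decide +kernel

theorem sum_adj_eq_twice_ncard_edgeSet {V : Type*} [Fintype V] (G : SimpleGraph V) :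
    ∑ u, ∑ v, (if G.Adj u v then 1 else 0) = 2 * G.edgeSet.ncard := by
  rw [← coe_edgeFinset, Set.ncard_coe_finset, ← sum_degrees_eq_twice_card_edges]
  simp [← card_neighborFinset_eq_degree, neighborFinset_eq_filter]

/-- A bicyclic graph of order `6` and diameter at most `2` has Wiener index at most `23`. -/
theorem wienerIndex_le_of_dist_le_two {V : Type*} [Fintype V] {G : SimpleGraph V}
    (hcard : Fintype.card V = 6) (hbic : G.edgeSet.ncard = 7)
    (hdist : ∀ u v, G.dist u v ≤ 2) : wienerIndex G ≤ 23 := by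
  have hpair : ∀ u v,
      G.dist u v + (if G.Adj u v then 1 else 0) + (if u = v then 2 else 0) ≤ 2 := by
    intro u v
    by_cases huv : u = v
    · simp [huv]
    · by_cases hadj : G.Adj u v
      · simp [huv, hadj, dist_eq_one_iff_adj.mpr hadj]
      · simpa [huv, hadj] using hdist u v
  have hsum := Finset.sum_le_sum fun u (_ : u ∈ univ) =>
    Finset.sum_le_sum fun v (_ : v ∈ univ) => hpair u v
  simp only [Finset.sum_add_distrib, sum_adj_eq_twice_ncard_edgeSet, hbic] at hsum
  simp [hcard] at hsum
  have hle : ∑ u, ∑ v, G.dist u v ≤ 46 := by omega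
  have hle' : ∑ u, ∑ v, (G.dist u v : ℚ) ≤ 46 := by exact_mod_cast hle
  unfold wienerIndex
  linarith

/-- Two vertices at distance at least `3` yield an induced path on four vertices. -/
theorem exists_induced_path_of_three_le_dist {V : Type*} {G : SimpleGraph V}
    (hconn : G.Connected) {u v : V} (huv : 3 ≤ G.dist u v) :
    ∃ a b c d, G.Adj a b ∧ G.Adj b c ∧ G.Adj c d ∧ ¬ G.Adj a c ∧ ¬ G.Adj a d ∧ ¬ G.Adj b d ∧
      a ≠ c ∧ a ≠ d ∧ b ≠ d := by
  obtain ⟨p, hp⟩ := hconn.exists_walk_length_eq_dist u v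
  match p, hp with
  | .nil, hp | .cons _ .nil, hp | .cons _ (.cons _ .nil), hp =>
    simp only [Walk.length_cons, Walk.length_nil] at hp
    omega
  | .cons (v := b) hab (.cons (v := c) hbc (.cons (v := d) hcd q)), hp =>
    simp only [Walk.length_cons] at hp
    refine ⟨u, b, c, d, hab, hbc, hcd, fun h => ?_, fun h => ?_, fun h => ?_, ?_, ?_, ?_⟩
    · have := dist_le (Walk.cons h (Walk.cons hcd q))
      simp only [Walk.length_cons] at this
      omega
    · have := dist_le (Walk.cons h q)
      simp only [Walk.length_cons] at this
      omega
    · have := dist_le (Walk.cons hab (Walk.cons h q))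
      simp only [Walk.length_cons] at this
      omega
    · rintro rfl
      have := dist_le (Walk.cons hcd q)
      simp only [Walk.length_cons] at this
      omega
    · rintro rfl
      have := dist_le q
      omega
    · rintro rfl
      have := dist_le (Walk.cons hab q)
      simp only [Walk.length_cons] at this
      omega

/-- Four distinct elements of a six-element type are the first four in some enumeration. -/
theorem exists_equiv_fin_six {V : Type*} [Fintype V] (hcard : Fintype.card V = 6)
    {a b c d : V} (hab : a ≠ b) (hac : a ≠ c) (had : a ≠ d) (hbc : b ≠ c) (hbd : b ≠ d)
    (hcd : c ≠ d) : ∃ σ : Fin 6 ≃ V, σ 0 = a ∧ σ 1 = b ∧ σ 2 = c ∧ σ 3 = d := by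
  have hrest : (({a, b, c, d} : Finset V)ᶜ).card = 2 := by
    rw [Finset.card_compl, hcard]
    simp [*]
  obtain ⟨e, f, hef, hset⟩ := Finset.card_eq_two.mp hrest
  have he : e ∈ ({a, b, c, d} : Finset V)ᶜ := by simp [hset]
  have hf : f ∈ ({a, b, c, d} : Finset V)ᶜ := by simp [hset]
  simp only [Finset.mem_compl, Finset.mem_insert, Finset.mem_singleton, not_or] at he hf
  have hinj : Function.Injective ![a, b, c, d, e, f] := by
    rw [← List.nodup_ofFn]
    simp
    grind
  have hbij := (Fintype.bijective_iff_injective_and_card _).mpr ⟨hinj, by simp [hcard]⟩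
  exact ⟨Equiv.ofBijective _ hbij, rfl, rfl, rfl, rfl⟩

/-- A graph on `Fin 6` in which `0, 1, 2, 3` is an induced path is given by a
`pathExtension` matrix. -/
theorem exists_adj_iff_pathExtension {H : SimpleGraph (Fin 6)} (h01 : H.Adj 0 1) (h12 : H.Adj 1 2)
    (h23 : H.Adj 2 3) (h02 : ¬ H.Adj 0 2) (h03 : ¬ H.Adj 0 3) (h13 : ¬ H.Adj 1 3) :
    ∃ p₀ p₁ p₂ p₃ q₀ q₁ q₂ q₃ r,
      ∀ i j, H.Adj i j ↔ pathExtension p₀ p₁ p₂ p₃ q₀ q₁ q₂ q₃ r i j := by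
  refine ⟨H.Adj 0 4, H.Adj 1 4, H.Adj 2 4, H.Adj 3 4, H.Adj 0 5, H.Adj 1 5, H.Adj 2 5,
    H.Adj 3 5, H.Adj 4 5, fun i j => ?_⟩
  have h20 : ¬ H.Adj 2 0 := fun h => h02 h.symm
  have h30 : ¬ H.Adj 3 0 := fun h => h03 h.symm
  have h31 : ¬ H.Adj 3 1 := fun h => h13 h.symm
  fin_cases i <;> fin_cases j <;>
    simp [pathExtension, h01, h12, h23, h01.symm, h12.symm, h23.symm, h02, h03, h13, h20, h30,
      h31]
  all_goals exact H.adj_comm _ _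

/-- Bicyclic graphs of order `6` outside
`{B(6,0), B(6,1), B_6^{(1)}, B_6^{3,3}}`. -/
theorem bicyclic_wiener_order_six
    {V : Type*} [Fintype V] (G : SimpleGraph V)
    (hcard : Fintype.card V = 6)
    (hconn : G.Connected) (hbic : G.edgeSet.ncard = 7)
    (hB1 : ¬ Nonempty (G ≃g Bgraph 6 0)) (hB2 : ¬ Nonempty (G ≃g Bgraph 6 1))
    (hB3 : ¬ Nonempty (G ≃g Bn1 6)) (hB4 : ¬ Nonempty (G ≃g B33 6)) :
    wienerIndex G < wienerIndex (Bn1 6) ∧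
    wienerIndex (Bn1 6) < wienerIndex (Bgraph 6 1) ∧
    wienerIndex (Bgraph 6 1) = wienerIndex (B33 6) ∧
    wienerIndex (B33 6) < wienerIndex (Bgraph 6 0) := by
  rw [wienerIndex_Bgraph_zero, wienerIndex_Bgraph_one, wienerIndex_Bn1, wienerIndex_B33]
  refine ⟨?_, by norm_num, rfl, by norm_num⟩
  by_cases hdist : ∀ u v, G.dist u v ≤ 2
  · linarith [wienerIndex_le_of_dist_le_two hcard hbic hdist]
  push Not at hdist
  obtain ⟨u, v, huv⟩ := hdist
  obtain ⟨a, b, c, d, hab, hbc, hcd, hac, had, hbd, hac', had', hbd'⟩ :=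
    exists_induced_path_of_three_le_dist hconn huv
  obtain ⟨σ, rfl, rfl, rfl, rfl⟩ :=
    exists_equiv_fin_six hcard hab.ne hac' had' hbc.ne hbd' hcd.ne
  let H : SimpleGraph (Fin 6) := G.comap σ
  let e : H ≃g G := Iso.comap σ G
  have hH : H.Connected := e.connected_iff.mpr hconn
  obtain ⟨p₀, p₁, p₂, p₃, q₀, q₁, q₂, q₃, r, hadj⟩ :=
    exists_adj_iff_pathExtension (H := H) hab hbc hcd hac had hbd
  have hsum : ∑ i, ∑ j, (if H.Adj i j then 1 else 0) = 14 := by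
    have h := sum_adj_eq_twice_ncard_edgeSet G
    rw [hbic, ← σ.sum_comp] at h
    simp_rw [← σ.sum_comp (fun v => if G.Adj _ v then 1 else 0)] at h
    exact h
  have hdeg : ∀ i, ∃ j, H.Adj i j := fun i => hH.preconnected.exists_adj_of_nontrivial i
  have h4 := hdeg 4
  have h5 := hdeg 5
  rw [← wienerIndex_congr e hH]
  simp only [hadj] at h4 h5
  have hnum : p₀.toNat + p₁.toNat + p₂.toNat + p₃.toNat + q₀.toNat + q₁.toNat + q₂.toNat
      + q₃.toNat + r.toNat = 4 := by
    have hterm : ∀ i j, (if H.Adj i j then 1 else 0) =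
        (pathExtension p₀ p₁ p₂ p₃ q₀ q₁ q₂ q₃ r i j).toNat := fun i j => by
      by_cases h : H.Adj i j
      · rw [if_pos h, (hadj i j).mp h, Bool.toNat_true]
      · rw [if_neg h, Bool.eq_false_iff.mpr (mt (hadj i j).mpr h), Bool.toNat_false]
    simp only [hterm, Fin.sum_univ_six, pathExtension, Matrix.cons_val, Bool.toNat_true,
      Bool.toNat_false] at hsum
    omega
  have hiso : ∀ {T : Fin 6 → Fin 6 → Bool} {K : SimpleGraph (Fin 6)},
      (∀ i j, K.Adj i j ↔ T i j) → ¬ Nonempty (G ≃g K) →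
      ¬ isRelabelling (pathExtension p₀ p₁ p₂ p₃ q₀ q₁ q₂ q₃ r) T := by
    intro T K hT hK hrel
    obtain ⟨φ⟩ := nonempty_iso_of_isRelabelling hadj hT hrel
    exact hK ⟨e.symm.trans φ⟩
  rcases pathExtension_cases p₀ p₁ p₂ p₃ q₀ q₁ q₂ q₃ r hnum
      (by simpa [Fin.exists_fin_succ, pathExtension, or_assoc] using h4)
      (by simpa [Fin.exists_fin_succ, pathExtension, or_assoc] using h5)
    with hlt | h | h | h | h
  · have hlt' : (distTableSum (pathExtension p₀ p₁ p₂ p₃ q₀ q₁ q₂ q₃ r) : ℚ)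
        < 52 := by exact_mod_cast hlt
    linarith [wienerIndex_le_distTableSum hadj (by omega)]
  · exact absurd h (hiso (Bgraph_adj 0) hB1)
  · exact absurd h (hiso (Bgraph_adj 1) hB2)
  · exact absurd h (hiso Bn1_adj hB3)
  · exact absurd h (hiso B33_adj hB4)
end
end

section
/- Let G_1 and G_2 be vertex-disjoint connected graphs and let G be the graph obtained by identifying a vertex of G_1 with a vertex of G_2; denote the common vertex by v. Then W(G) = W(G_1) + W(G_2) + (|V_{G_2}| − 1)·D_{G_1}(v) + (|V_{G_1}| − 1)·D_{G_2}(v). -/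
open SimpleGraph Finset
open scoped Classical

noncomputable section

/-- The vertex of `glue G₁ G₂ v₁ v₂` coming from a vertex of `G₂`. -/
def glueInr {V₁ V₂ : Type*} (v₁ : V₁) (v₂ : V₂) (x : V₂) : V₁ ⊕ {x : V₂ // x ≠ v₂} :=
  if h : x = v₂ then Sum.inl v₁ else Sum.inr ⟨x, h⟩

/-- The retraction of the glued vertex set onto `V₁`. -/
def glueFst {V₁ V₂ : Type*} (v₁ : V₁) (v₂ : V₂) : V₁ ⊕ {x : V₂ // x ≠ v₂} → V₁ :=
  Sum.elim id fun _ => v₁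

/-- The retraction of the glued vertex set onto `V₂`. -/
def glueSnd {V₁ V₂ : Type*} (v₂ : V₂) : V₁ ⊕ {x : V₂ // x ≠ v₂} → V₂ :=
  Sum.elim (fun _ => v₂) Subtype.val

section GlueDist

variable {V₁ V₂ : Type*} (G₁ : SimpleGraph V₁) (G₂ : SimpleGraph V₂) (v₁ : V₁) (v₂ : V₂)

theorem glue_adj_inl {a b : V₁} (h : G₁.Adj a b) :
    (glue G₁ G₂ v₁ v₂).Adj (Sum.inl a) (Sum.inl b) := by
  simp [glue, h, h.ne]

theorem glue_adj_glueInr {a b : V₂} (h : G₂.Adj a b) :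
    (glue G₁ G₂ v₁ v₂).Adj (glueInr v₁ v₂ a) (glueInr v₁ v₂ b) := by
  have hne := h.ne
  have hs := h.symm
  unfold glueInr
  split_ifs with ha hb hb <;> simp_all [glue]

/-- Every edge of the glued graph projects to an edge in one of the two factors and to a
single vertex in the other. -/
theorem glue_adj_proj {u w : V₁ ⊕ {x : V₂ // x ≠ v₂}} (h : (glue G₁ G₂ v₁ v₂).Adj u w) :
    (G₁.Adj (glueFst v₁ v₂ u) (glueFst v₁ v₂ w) ∧ glueSnd v₂ u = glueSnd v₂ w) ∨
      (glueFst v₁ v₂ u = glueFst v₁ v₂ w ∧ G₂.Adj (glueSnd v₂ u) (glueSnd v₂ w)) := by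
  rcases u with a | a <;> rcases w with b | b <;>
    simp only [glue, SimpleGraph.fromRel_adj, glueFst, glueSnd, Sum.elim_inl, Sum.elim_inr,
      id] at h ⊢
  · exact Or.inl ⟨h.2.elim id SimpleGraph.Adj.symm, trivial⟩
  · exact Or.inr (by simpa using h.2)
  · exact Or.inr (by simpa [eq_comm, SimpleGraph.adj_comm] using h.2)
  · exact Or.inr ⟨trivial, h.2.elim id SimpleGraph.Adj.symm⟩

theorem dist_proj_le_length (h₁ : G₁.Connected) (h₂ : G₂.Connected)
    {u w : V₁ ⊕ {x : V₂ // x ≠ v₂}} (p : (glue G₁ G₂ v₁ v₂).Walk u w) :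
    G₁.dist (glueFst v₁ v₂ u) (glueFst v₁ v₂ w) + G₂.dist (glueSnd v₂ u) (glueSnd v₂ w)
      ≤ p.length := by
  induction p with
  | nil => simp
  | @cons u x w h p ih =>
    rw [SimpleGraph.Walk.length_cons]
    rcases glue_adj_proj G₁ G₂ v₁ v₂ h with ⟨hadj, heq⟩ | ⟨heq, hadj⟩
    · have := h₁.dist_triangle (u := glueFst v₁ v₂ u) (v := glueFst v₁ v₂ x)
        (w := glueFst v₁ v₂ w)
      rw [SimpleGraph.dist_eq_one_iff_adj.2 hadj] at this
      rw [heq]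
      omega
    · have := h₂.dist_triangle (u := glueSnd v₂ u) (v := glueSnd v₂ x) (w := glueSnd v₂ w)
      rw [SimpleGraph.dist_eq_one_iff_adj.2 hadj] at this
      rw [heq]
      omega

theorem exists_glue_walk_inl (h₁ : G₁.Connected) (a b : V₁) :
    ∃ p : (glue G₁ G₂ v₁ v₂).Walk (Sum.inl a) (Sum.inl b), p.length = G₁.dist a b := by
  obtain ⟨p, hp⟩ := h₁.exists_walk_length_eq_dist a b
  exact ⟨p.map ⟨Sum.inl, glue_adj_inl G₁ G₂ v₁ v₂⟩, by simpa using hp⟩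

theorem exists_glue_walk_glueInr (h₂ : G₂.Connected) (a b : V₂) :
    ∃ p : (glue G₁ G₂ v₁ v₂).Walk (glueInr v₁ v₂ a) (glueInr v₁ v₂ b),
      p.length = G₂.dist a b := by
  obtain ⟨p, hp⟩ := h₂.exists_walk_length_eq_dist a b
  exact ⟨p.map ⟨glueInr v₁ v₂, glue_adj_glueInr G₁ G₂ v₁ v₂⟩, by simpa using hp⟩

theorem exists_glue_walk (h₁ : G₁.Connected) (h₂ : G₂.Connected)
    (u w : V₁ ⊕ {x : V₂ // x ≠ v₂}) :
    ∃ p : (glue G₁ G₂ v₁ v₂).Walk u w, p.length =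
      G₁.dist (glueFst v₁ v₂ u) (glueFst v₁ v₂ w) + G₂.dist (glueSnd v₂ u) (glueSnd v₂ w) := by
  have inr_eq (x : {x : V₂ // x ≠ v₂}) : glueInr v₁ v₂ x.1 = Sum.inr x := by
    simp [glueInr, x.2]
  have base_eq : glueInr v₁ v₂ v₂ = Sum.inl v₁ := by simp [glueInr]
  rcases u with a | a <;> rcases w with b | b <;>
    simp only [glueFst, glueSnd, Sum.elim_inl, Sum.elim_inr, id, SimpleGraph.dist_self,
      add_zero, zero_add]
  · exact exists_glue_walk_inl G₁ G₂ v₁ v₂ h₁ a b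
  · obtain ⟨p, hp⟩ := exists_glue_walk_inl G₁ G₂ v₁ v₂ h₁ a v₁
    obtain ⟨q, hq⟩ := exists_glue_walk_glueInr G₁ G₂ v₁ v₂ h₂ v₂ b
    rw [← inr_eq]
    exact ⟨p.append (q.copy base_eq rfl), by simp [hp, hq]⟩
  · obtain ⟨p, hp⟩ := exists_glue_walk_inl G₁ G₂ v₁ v₂ h₁ v₁ b
    obtain ⟨q, hq⟩ := exists_glue_walk_glueInr G₁ G₂ v₁ v₂ h₂ a v₂
    rw [← inr_eq]
    exact ⟨(q.copy rfl base_eq).append p, by simp [hp, hq, add_comm]⟩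
  · rw [← inr_eq a, ← inr_eq b]
    exact exists_glue_walk_glueInr G₁ G₂ v₁ v₂ h₂ a b

/-- Distances in the glued graph are the sums of the distances between the projections. -/
theorem glue_dist (h₁ : G₁.Connected) (h₂ : G₂.Connected)
    (u w : V₁ ⊕ {x : V₂ // x ≠ v₂}) :
    (glue G₁ G₂ v₁ v₂).dist u w =
      G₁.dist (glueFst v₁ v₂ u) (glueFst v₁ v₂ w) +
        G₂.dist (glueSnd v₂ u) (glueSnd v₂ w) := by
  obtain ⟨p, hp⟩ := exists_glue_walk G₁ G₂ v₁ v₂ h₁ h₂ u w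
  obtain ⟨q, hq⟩ := p.reachable.exists_walk_length_eq_dist
  exact le_antisymm (hp ▸ SimpleGraph.dist_le p)
    (hq ▸ dist_proj_le_length G₁ G₂ v₁ v₂ h₁ h₂ q)

end GlueDist

theorem sum_subtype_ne {V : Type*} [Fintype V] (v : V) (f : V → ℚ) :
    ∑ x : {x : V // x ≠ v}, f x = ∑ x, f x - f v := by
  rw [Fintype.sum_eq_add_sum_subtype_ne f v, add_sub_cancel_left]

/-- Wiener index of a graph obtained by identifying a vertex of `G₁`
with a vertex of `G₂`. -/
theorem wiener_glue
    {V₁ V₂ : Type*} [Fintype V₁] [Fintype V₂]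
    (G₁ : SimpleGraph V₁) (G₂ : SimpleGraph V₂)
    (h₁ : G₁.Connected) (h₂ : G₂.Connected) (v₁ : V₁) (v₂ : V₂) :
    wienerIndex (glue G₁ G₂ v₁ v₂) =
      wienerIndex G₁ + wienerIndex G₂ +
        ((Fintype.card V₂ : ℚ) - 1) * transmission G₁ v₁ +
        ((Fintype.card V₁ : ℚ) - 1) * transmission G₂ v₂ := by
  have hcard : (Fintype.card {x : V₂ // x ≠ v₂} : ℚ) = Fintype.card V₂ - 1 := by
    simpa using sum_subtype_ne v₂ fun _ => (1 : ℚ)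
  have hfst : ∑ b, (G₁.dist v₁ b : ℚ) = transmission G₁ v₁ := by
    simp only [transmission, SimpleGraph.dist_comm]
  have hfst' : ∑ a, (G₁.dist a v₁ : ℚ) = transmission G₁ v₁ := rfl
  have hsnd : ∑ b, (G₂.dist v₂ b : ℚ) = transmission G₂ v₂ := by
    simp only [transmission, SimpleGraph.dist_comm]
  have hsnd_ne : ∑ b : {x : V₂ // x ≠ v₂}, (G₂.dist v₂ b : ℚ) = transmission G₂ v₂ := by
    rw [sum_subtype_ne v₂ fun b => (G₂.dist v₂ b : ℚ), hsnd]; simp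
  have hsnd_ne' : ∑ b : {x : V₂ // x ≠ v₂}, (G₂.dist b v₂ : ℚ) = transmission G₂ v₂ := by
    rw [← hsnd_ne]; simp only [SimpleGraph.dist_comm]
  have hsum : ∑ a : {x : V₂ // x ≠ v₂}, ∑ b : {x : V₂ // x ≠ v₂}, (G₂.dist a b : ℚ) =
      ∑ a, ∑ b, (G₂.dist a b : ℚ) - 2 * transmission G₂ v₂ := by
    have inner (a : V₂) : ∑ b : {x : V₂ // x ≠ v₂}, (G₂.dist a b : ℚ) =
        ∑ b, (G₂.dist a b : ℚ) - G₂.dist a v₂ :=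
      sum_subtype_ne v₂ fun b => (G₂.dist a b : ℚ)
    simp only [inner]
    rw [sum_subtype_ne v₂ fun a => ∑ b, (G₂.dist a b : ℚ) - (G₂.dist a v₂ : ℚ),
      Finset.sum_sub_distrib, hsnd, ← transmission]
    simp only [SimpleGraph.dist_self, Nat.cast_zero]
    ring
  simp only [wienerIndex, glue_dist G₁ G₂ v₁ v₂ h₁ h₂, Fintype.sum_sum_type, glueFst, glueSnd,
    Sum.elim_inl, Sum.elim_inr, id, SimpleGraph.dist_self, Nat.cast_add,
    Finset.sum_add_distrib, hsum, hsnd_ne, hsnd_ne', hfst, Finset.sum_const,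
    Finset.card_univ, nsmul_eq_mul, hcard, ← Finset.mul_sum, hfst']
  ring
end
end

section
/- Let r be an even integer with 4 ≤ r < n. Then the Wiener index of the lollipop satisfies W(L_{n,r}) = (1/6)·[n³ + (−(3/2)r² + 3r − 1)·n + ((5/4)r³ − 3r² + r)]. -/
open SimpleGraph Finset
open scoped Classical

noncomputable section

/-- A function that vanishes only at `u`, grows by at most one along edges, and can be decreased by
one along some edge wherever it is positive, is the distance from `u`. -/
theorem SimpleGraph.dist_eq_of_descent {V : Type*} {G : SimpleGraph V} {u : V} {f : V → ℕ}
    (hzero : ∀ v, f v = 0 ↔ v = u) (hadj : ∀ v w, G.Adj v w → f w ≤ f v + 1)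
    (hdesc : ∀ v, f v ≠ 0 → ∃ w, G.Adj w v ∧ f w + 1 = f v) (v : V) :
    G.dist u v = f v := by
  have hwalk : ∀ k v, f v = k → ∃ p : G.Walk u v, p.length = k := by
    intro k
    induction k with
    | zero =>
      intro v hv
      obtain rfl := (hzero v).1 hv
      exact ⟨.nil, rfl⟩
    | succ k ih =>
      intro v hv
      obtain ⟨w, hwv, hw⟩ := hdesc v (by omega)
      obtain ⟨p, hp⟩ := ih w (by omega)
      exact ⟨p.concat hwv, by simp [hp]⟩
  have hlower : ∀ {x y : V} (p : G.Walk x y), f y ≤ f x + p.length := by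
    intro x y p
    induction p with
    | nil => simp
    | cons h p ih =>
      have := hadj _ _ h
      rw [Walk.length_cons]
      omega
  obtain ⟨p, hp⟩ := hwalk _ v rfl
  obtain ⟨q, hq⟩ := p.reachable.exists_walk_length_eq_dist
  have h₁ := dist_le p
  have h₂ := hlower q
  have h₃ := (hzero u).2 rfl
  omega

/-- The distance between the vertices numbered `a` and `b` in a lollipop with cycle length `r`:
the distance of their projections to the cycle plus the difference of their depths in the path. -/
def lollipopDist (r a b : ℕ) : ℕ :=
  min ((min a (r - 1) - min b (r - 1)) + (min b (r - 1) - min a (r - 1)))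
      (r - ((min a (r - 1) - min b (r - 1)) + (min b (r - 1) - min a (r - 1)))) +
    ((a - (r - 1) - (b - (r - 1))) + (b - (r - 1) - (a - (r - 1))))

theorem lollipopDist_comm (r a b : ℕ) : lollipopDist r a b = lollipopDist r b a := by
  unfold lollipopDist
  omega

theorem lollipopDist_self (r a : ℕ) : lollipopDist r a a = 0 := by
  unfold lollipopDist
  omega

theorem lollipopDist_of_lt_of_lt {r a b : ℕ} (ha : a < r) (hb : b < r) :
    lollipopDist r a b = min ((a - b) + (b - a)) (r - ((a - b) + (b - a))) := by
  rw [lollipopDist, show min a (r - 1) = a by omega, show min b (r - 1) = b by omega]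
  omega

theorem lollipopDist_of_lt_of_le {r a b : ℕ} (ha : a < r) (hb : r ≤ b + 1) :
    lollipopDist r a b = min (r - 1 - a) (a + 1) + (b + 1 - r) := by
  rw [lollipopDist, show min a (r - 1) = a by omega, show min b (r - 1) = r - 1 by omega]
  omega

theorem lollipopDist_of_le_of_lt {r a b : ℕ} (ha : r ≤ a + 1) (hb : b < r) :
    lollipopDist r a b = min (r - 1 - b) (b + 1) + (a + 1 - r) := by
  rw [lollipopDist_comm, lollipopDist_of_lt_of_le hb ha]

theorem lollipopDist_of_le_of_le {r a b : ℕ} (ha : r ≤ a + 1) (hb : r ≤ b + 1) :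
    lollipopDist r a b = (a - b) + (b - a) := by
  rw [lollipopDist, show min a (r - 1) = r - 1 by omega, show min b (r - 1) = r - 1 by omega]
  omega

theorem lollipopDist_eq_zero_iff {r a b : ℕ} : lollipopDist r a b = 0 ↔ b = a := by
  rcases lt_or_ge a r with ha | ha <;> rcases lt_or_ge b r with hb | hb
  · rw [lollipopDist_of_lt_of_lt ha hb]
    omega
  · rw [lollipopDist_of_lt_of_le ha (by omega)]
    omega
  · rw [lollipopDist_of_le_of_lt (by omega) hb]
    omega
  · rw [lollipopDist_of_le_of_le (by omega) (by omega)]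
    omega

/-- The distances from `a` to two consecutive vertices differ by at most one. -/
theorem lollipopDist_succ_le {r : ℕ} (a b : ℕ) :
    lollipopDist r a (b + 1) ≤ lollipopDist r a b + 1 ∧
      lollipopDist r a b ≤ lollipopDist r a (b + 1) + 1 := by
  rcases lt_or_ge a r with ha | ha <;> rcases lt_or_ge (b + 1) r with hb | hb
  · rw [lollipopDist_of_lt_of_lt ha hb, lollipopDist_of_lt_of_lt ha (by omega)]
    omega
  · rw [lollipopDist_of_lt_of_le ha (by omega), lollipopDist_of_lt_of_le ha hb]
    omega
  · rw [lollipopDist_of_le_of_lt (by omega) hb, lollipopDist_of_le_of_lt (by omega) (by omega)]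
    omega
  · rw [lollipopDist_of_le_of_le (by omega) (by omega),
      lollipopDist_of_le_of_le (by omega) (by omega)]
    omega

/-- The distances from `a` to the ends of the edge closing the cycle differ by at most one. -/
theorem lollipopDist_zero_le {r : ℕ} (hr : 1 ≤ r) (a : ℕ) :
    lollipopDist r a (r - 1) ≤ lollipopDist r a 0 + 1 ∧
      lollipopDist r a 0 ≤ lollipopDist r a (r - 1) + 1 := by
  rcases lt_or_ge a r with ha | ha
  · rw [lollipopDist_of_lt_of_lt ha (by omega), lollipopDist_of_lt_of_lt ha hr]
    omega
  · rw [lollipopDist_of_le_of_lt (by omega) (by omega), lollipopDist_of_le_of_lt (by omega) hr]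
    omega

theorem lollipop_adj {n r : ℕ} (hr : 3 ≤ r) (a b : Fin n) :
    (lollipop n r).Adj a b ↔ a.val + 1 = b.val ∨ (a.val = 0 ∧ b.val = r - 1) ∨
      b.val + 1 = a.val ∨ (b.val = 0 ∧ a.val = r - 1) := by
  rw [lollipop, fromRel_adj, ne_eq, Fin.ext_iff]
  omega

/-- Every vertex `b` other than `a` has a neighbour that is one step closer to `a`. -/
theorem exists_lollipopDist_descent {n r a b : ℕ} (hr : 1 ≤ r) (hrn : r ≤ n) (ha : a < n)
    (hb : b < n) (hab : b ≠ a) :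
    ∃ c < n, (c + 1 = b ∨ (c = 0 ∧ b = r - 1) ∨ b + 1 = c ∨ (b = 0 ∧ c = r - 1)) ∧
      lollipopDist r a c + 1 = lollipopDist r a b := by
  rcases lt_or_ge a r with har | har <;> rcases lt_or_ge b r with hbr | hbr
  · have key : ∃ c < r, (c + 1 = b ∨ (c = 0 ∧ b = r - 1) ∨ b + 1 = c ∨ (b = 0 ∧ c = r - 1)) ∧
        min ((a - c) + (c - a)) (r - ((a - c) + (c - a))) + 1 =
          min ((a - b) + (b - a)) (r - ((a - b) + (b - a))) := by
      by_cases h : b < a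
      · by_cases hs : 2 * (a - b) ≤ r
        · exact ⟨b + 1, by omega, by omega, by omega⟩
        · by_cases h0 : b = 0
          · exact ⟨r - 1, by omega, by omega, by omega⟩
          · exact ⟨b - 1, by omega, by omega, by omega⟩
      · by_cases hs : 2 * (b - a) ≤ r
        · exact ⟨b - 1, by omega, by omega, by omega⟩
        · by_cases h0 : b = r - 1
          · exact ⟨0, by omega, by omega, by omega⟩
          · exact ⟨b + 1, by omega, by omega, by omega⟩
    obtain ⟨c, hc, hadj, hd⟩ := key
    refine ⟨c, by omega, hadj, ?_⟩
    rwa [lollipopDist_of_lt_of_lt har hc, lollipopDist_of_lt_of_lt har hbr]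
  · refine ⟨b - 1, by omega, by omega, ?_⟩
    rw [lollipopDist_of_lt_of_le har (by omega), lollipopDist_of_lt_of_le har (by omega)]
    omega
  · by_cases hlast : b = r - 1
    · refine ⟨b + 1, by omega, by omega, ?_⟩
      rw [lollipopDist_of_le_of_le (by omega) (by omega),
        lollipopDist_of_le_of_le (by omega) (by omega)]
      omega
    · have key : ∃ c < r, (c + 1 = b ∨ (c = 0 ∧ b = r - 1) ∨ b + 1 = c ∨ (b = 0 ∧ c = r - 1)) ∧
          min (r - 1 - c) (c + 1) + 1 = min (r - 1 - b) (b + 1) := by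
        by_cases hs : 2 * (b + 1) ≤ r
        · by_cases h0 : b = 0
          · exact ⟨r - 1, by omega, by omega, by omega⟩
          · exact ⟨b - 1, by omega, by omega, by omega⟩
        · exact ⟨b + 1, by omega, by omega, by omega⟩
      obtain ⟨c, hc, hadj, hd⟩ := key
      refine ⟨c, by omega, hadj, ?_⟩
      rw [lollipopDist_of_le_of_lt (by omega) hc, lollipopDist_of_le_of_lt (by omega) hbr]
      omega
  · by_cases h : a < b
    · refine ⟨b - 1, by omega, by omega, ?_⟩
      rw [lollipopDist_of_le_of_le (by omega) (by omega),
        lollipopDist_of_le_of_le (by omega) (by omega)]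
      omega
    · refine ⟨b + 1, by omega, by omega, ?_⟩
      rw [lollipopDist_of_le_of_le (by omega) (by omega),
        lollipopDist_of_le_of_le (by omega) (by omega)]
      omega

theorem dist_lollipop {n r : ℕ} (hr : 3 ≤ r) (hrn : r ≤ n) (u v : Fin n) :
    (lollipop n r).dist u v = lollipopDist r u v := by
  have hr₁ : 1 ≤ r := by omega
  refine dist_eq_of_descent (f := fun v : Fin n => lollipopDist r u v) ?_ ?_ ?_ v
  · intro v
    rw [Fin.ext_iff]
    exact lollipopDist_eq_zero_iff
  · intro v w h
    rcases (lollipop_adj hr v w).1 h with h | ⟨hv, hw⟩ | h | ⟨hw, hv⟩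
    · simpa only [← h] using (lollipopDist_succ_le u.val v.val).1
    · simpa only [hv, hw] using (lollipopDist_zero_le hr₁ u.val).1
    · simpa only [← h] using (lollipopDist_succ_le u.val w.val).2
    · simpa only [hv, hw] using (lollipopDist_zero_le hr₁ u.val).2
  · intro v hv
    obtain ⟨c, hc, hadj, hd⟩ := exists_lollipopDist_descent hr₁ hrn u.isLt v.isLt
      (mt lollipopDist_eq_zero_iff.2 hv)
    exact ⟨⟨c, hc⟩, (lollipop_adj hr _ _).2 hadj, hd⟩

theorem sum_lollipopDist_zero (m : ℕ) :
    ∑ b ∈ range (2 * m), lollipopDist (2 * m) 0 b = m ^ 2 := by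
  rw [two_mul, sum_range_add, ← sum_add_distrib, sum_congr rfl (g := fun _ => m)]
  · simp [sq]
  · intro b hb
    rw [mem_range] at hb
    unfold lollipopDist
    omega

/-- In an even cycle of length `2 * m`, every vertex has transmission `m ^ 2`. -/
theorem sum_lollipopDist_cycle {m a : ℕ} (ha : a < 2 * m) :
    ∑ b ∈ range (2 * m), lollipopDist (2 * m) a b = m ^ 2 := by
  induction a with
  | zero => exact sum_lollipopDist_zero m
  | succ a ih =>
    rw [← ih (by omega)]
    obtain ⟨k, hk⟩ : ∃ k, 2 * m = k + 1 := ⟨2 * m - 1, by omega⟩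
    rw [hk, sum_range_succ', sum_range_succ]
    congr 1
    · refine sum_congr rfl fun b hb => ?_
      rw [mem_range] at hb
      unfold lollipopDist
      omega
    · unfold lollipopDist
      omega

/-- The transmission of the end-vertex `2 * m - 1 + k` in the lollipop induced on the vertices up to
it. -/
theorem sum_lollipopDist_last {m : ℕ} (hm : 1 ≤ m) (k : ℕ) :
    (∑ a ∈ range (2 * m + k), (lollipopDist (2 * m) a (2 * m - 1 + k) : ℚ)) =
      m ^ 2 + 2 * m * k + k * (k - 1) / 2 := by
  induction k with
  | zero =>
    have h := sum_lollipopDist_cycle (m := m) (a := 2 * m - 1) (by omega)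
    simp_rw [lollipopDist_comm _ (2 * m - 1)] at h
    simp [← Nat.cast_sum, h]
  | succ k ih =>
    have hstep : ∀ a ∈ range (2 * m + k),
        (lollipopDist (2 * m) a (2 * m - 1 + (k + 1)) : ℚ) =
          lollipopDist (2 * m) a (2 * m - 1 + k) + 1 := by
      intro a ha
      rw [mem_range] at ha
      norm_cast
      unfold lollipopDist
      omega
    have hself : lollipopDist (2 * m) (2 * m + k) (2 * m - 1 + (k + 1)) = 0 := by
      rw [show 2 * m - 1 + (k + 1) = 2 * m + k by omega, lollipopDist_self]
    rw [← add_assoc (2 * m) k 1, sum_range_succ, hself, sum_congr rfl hstep, sum_add_distrib, ih]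
    simp
    ring

/-- The sum of the distances over all ordered pairs of vertices. -/
theorem sum_sum_lollipopDist {m : ℕ} (hm : 1 ≤ m) (k : ℕ) :
    (∑ a ∈ range (2 * m + k), ∑ b ∈ range (2 * m + k), (lollipopDist (2 * m) a b : ℚ)) =
      2 * m ^ 3 + 2 * (m ^ 2 * k + m * k * (k + 1) + (k + 1) * k * (k - 1) / 6) := by
  induction k with
  | zero =>
    have h : ∀ a ∈ range (2 * m), ∑ b ∈ range (2 * m), (lollipopDist (2 * m) a b : ℚ) = m ^ 2 := by
      intro a ha
      exact_mod_cast sum_lollipopDist_cycle (mem_range.1 ha)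
    rw [add_zero, sum_congr rfl h]
    simp
    ring
  | succ k ih =>
    have hlast := sum_lollipopDist_last hm (k + 1)
    rw [show 2 * m - 1 + (k + 1) = 2 * m + k by omega, ← add_assoc, sum_range_succ,
      lollipopDist_self] at hlast
    rw [← add_assoc, sum_range_succ]
    simp_rw [sum_range_succ _ (2 * m + k)]
    rw [sum_add_distrib, ih, lollipopDist_self]
    simp_rw [lollipopDist_comm _ (2 * m + k)]
    push_cast at hlast ⊢
    linear_combination 2 * hlast

/-- Wiener index of the lollipop `L_{n,r}` for even `r` with
`4 ≤ r < n`. -/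
theorem wiener_lollipop_even
    (n r : ℕ) (hr : 4 ≤ r) (hrn : r < n) (heven : Even r) :
    wienerIndex (lollipop n r) =
      (1 / 6) * ((n : ℚ) ^ 3 + (-(3 / 2) * (r : ℚ) ^ 2 + 3 * r - 1) * n +
        ((5 / 4) * (r : ℚ) ^ 3 - 3 * (r : ℚ) ^ 2 + r)) := by
  obtain ⟨m, hm⟩ := heven
  obtain rfl : r = 2 * m := by omega
  obtain ⟨k, rfl⟩ := Nat.exists_eq_add_of_le hrn.le
  have hsum := sum_sum_lollipopDist (m := m) (by omega) k
  rw [← Fin.sum_univ_eq_sum_range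
    (fun a => ∑ b ∈ range (2 * m + k), (lollipopDist (2 * m) a b : ℚ))] at hsum
  simp_rw [← Fin.sum_univ_eq_sum_range (fun b => (lollipopDist (2 * m) _ b : ℚ))] at hsum
  simp_rw [wienerIndex, dist_lollipop (by omega : 3 ≤ 2 * m) hrn.le]
  rw [hsum]
  push_cast
  ring
end
end

section
/- Let G = C_r(P_{n_1+1},…,P_{n_r+1}) be an n-vertex unicyclic graph with at least two non-trivial attached paths, say at positions k and t (so n_k ≥ 1 and n_t ≥ 1, k ≠ t). (i) If Σ_{i≠k,t} (n_i+1)·d_G(v_i,v_k) ≤ Σ_{i≠k,t} (n_i+1)·d_G(v_i,v_t), then W(G) < W(G_1), where G_1 is obtained from G by removing the attached path at v_k and replacing the attached path at v_t by a path on n_k + n_t + 1 vertices (all other attachments unchanged). (ii) If Σ_{i≠k,t} (n_i+1)·d_G(v_i,v_k) > Σ_{i≠k,t} (n_i+1)·d_G(v_i,v_t), then W(G) < W(G_2), where G_2 is obtained from G by removing the attached path at v_t and replacing the attached path at v_k by a path on n_k + n_t + 1 vertices. -/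
open SimpleGraph Finset
open scoped Classical

noncomputable section

/-- A function that vanishes only on the diagonal, changes by at most one along edges and can
always be decreased along some edge is the graph distance. -/
theorem SimpleGraph.dist_eq_of_lipschitz_of_descent {V : Type*} (G : SimpleGraph V)
    (f : V → V → ℕ) (hself : ∀ w, f w w = 0) (hzero : ∀ w v, f w v = 0 → w = v)
    (hlip : ∀ w u v, G.Adj u v → f w v ≤ f w u + 1)
    (hdesc : ∀ w v, f w v ≠ 0 → ∃ u, G.Adj u v ∧ f w u + 1 = f w v) (w v : V) :
    G.dist w v = f w v := by
  have hwalk : ∀ n v, f w v = n → ∃ p : G.Walk w v, p.length = n := by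
    intro n
    induction n with
    | zero =>
      intro v hv
      obtain rfl := hzero w v hv
      exact ⟨Walk.nil, rfl⟩
    | succ n ih =>
      intro v hv
      obtain ⟨u, hu, hfu⟩ := hdesc w v (by omega)
      obtain ⟨p, hp⟩ := ih u (by omega)
      exact ⟨p.concat hu, by simp [hp]⟩
  have hle : ∀ a b (p : G.Walk a b), f w b ≤ f w a + p.length := by
    intro a b p
    induction p with
    | nil => simp
    | cons h p ih =>
      have := hlip w _ _ h
      rw [Walk.length_cons]
      omega
  obtain ⟨p, hp⟩ := hwalk _ v rfl
  obtain ⟨q, hq⟩ := p.reachable.exists_walk_length_eq_dist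
  have h1 := dist_le p
  have h2 := hle w v q
  rw [hself] at h2
  omega

/-- The distance between the positions `i` and `j` on the cycle of length `r`. -/
def cyclicDist (r i j : ℕ) : ℕ := min ((i - j) + (j - i)) (r - ((i - j) + (j - i)))

theorem cyclicDist_self (r i : ℕ) : cyclicDist r i i = 0 := by simp [cyclicDist]

theorem cyclicDist_comm (r i j : ℕ) : cyclicDist r i j = cyclicDist r j i := by
  simp only [cyclicDist, Nat.add_comm]

/-- The distance formula in `cyclePaths r m`. -/
def cyclePathsDist (r : ℕ) (m : Fin r → ℕ) (u v : Σ i : Fin r, Fin (m i + 1)) : ℕ :=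
  if u.1.val = v.1.val then (u.2.val - v.2.val) + (v.2.val - u.2.val)
  else u.2.val + cyclicDist r u.1.val v.1.val + v.2.val

theorem succ_mod_eq_iff {r i j : ℕ} (hi : i < r) (hj : j < r) :
    (i + 1) % r = j ↔ i + 1 = j ∨ (i + 1 = r ∧ j = 0) := by
  rcases Nat.lt_or_ge (i + 1) r with h | h
  · rw [Nat.mod_eq_of_lt h]
    omega
  · obtain rfl : r = i + 1 := by omega
    rw [Nat.mod_self]
    omega

theorem cyclePaths_adj {r : ℕ} {m : Fin r → ℕ} (u v : Σ i : Fin r, Fin (m i + 1)) :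
    (cyclePaths r m).Adj u v ↔ ¬ (u.1.val = v.1.val ∧ u.2.val = v.2.val) ∧
      (((u.2.val = 0 ∧ v.2.val = 0 ∧
          (u.1.val + 1 = v.1.val ∨ (u.1.val + 1 = r ∧ v.1.val = 0))) ∨
        (u.1.val = v.1.val ∧ u.2.val + 1 = v.2.val)) ∨
      ((v.2.val = 0 ∧ u.2.val = 0 ∧
          (v.1.val + 1 = u.1.val ∨ (v.1.val + 1 = r ∧ u.1.val = 0))) ∨
        (v.1.val = u.1.val ∧ v.2.val + 1 = u.2.val))) := by
  have hne : u = v ↔ u.1.val = v.1.val ∧ u.2.val = v.2.val := by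
    constructor
    · rintro rfl
      exact ⟨rfl, rfl⟩
    · obtain ⟨i, x⟩ := u
      obtain ⟨j, y⟩ := v
      rintro ⟨h, h'⟩
      obtain rfl := Fin.ext h
      obtain rfl := Fin.ext h'
      rfl
  rw [cyclePaths, fromRel_adj, ne_eq, hne, succ_mod_eq_iff u.1.isLt v.1.isLt,
    succ_mod_eq_iff v.1.isLt u.1.isLt, Fin.ext_iff, Fin.ext_iff]

theorem cyclicDist_le_succ {r i j l : ℕ} (hi : i < r) (hj : j < r) (hl : l < r)
    (h : j + 1 = l ∨ (j + 1 = r ∧ l = 0) ∨ l + 1 = j ∨ (l + 1 = r ∧ j = 0)) :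
    cyclicDist r i l ≤ cyclicDist r i j + 1 := by
  unfold cyclicDist
  omega

theorem cyclicDist_descent {r i j : ℕ} (hi : i < r) (hj : j < r) (hij : i ≠ j) :
    ∃ l < r, (j + 1 = l ∨ (j + 1 = r ∧ l = 0) ∨ l + 1 = j ∨ (l + 1 = r ∧ j = 0)) ∧
      cyclicDist r i l + 1 = cyclicDist r i j := by
  unfold cyclicDist
  by_cases hup : (i < j ∧ r < 2 * (j - i)) ∨ (j < i ∧ 2 * (i - j) ≤ r)
  · by_cases hlast : j + 1 = r
    · exact ⟨0, by omega, by omega, by omega⟩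
    · exact ⟨j + 1, by omega, by omega, by omega⟩
  · by_cases hfirst : j = 0
    · exact ⟨r - 1, by omega, by omega, by omega⟩
    · exact ⟨j - 1, by omega, by omega, by omega⟩

theorem cyclicDist_pos {r i j : ℕ} (hi : i < r) (hj : j < r) (hij : i ≠ j) :
    0 < cyclicDist r i j := by
  unfold cyclicDist
  omega

theorem cyclePaths_dist {r : ℕ} {m : Fin r → ℕ} (u v : Σ i : Fin r, Fin (m i + 1)) :
    (cyclePaths r m).dist u v = cyclePathsDist r m u v := by
  apply dist_eq_of_lipschitz_of_descent
  · intro w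
    simp [cyclePathsDist]
  · rintro ⟨i, x⟩ ⟨j, y⟩ h
    unfold cyclePathsDist at h
    split_ifs at h with hij
    · obtain rfl := Fin.ext hij
      obtain rfl : x = y := Fin.ext (by dsimp only at h; omega)
      rfl
    · have := cyclicDist_pos i.isLt j.isLt hij
      dsimp only at h
      omega
  · rintro ⟨i, x⟩ ⟨j, y⟩ ⟨l, z⟩ h
    rw [cyclePaths_adj] at h
    have hc := cyclicDist_le_succ (l := l.val) i.isLt j.isLt l.isLt
    have hl := cyclicDist_self r i.val
    unfold cyclePathsDist
    dsimp only at h ⊢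
    obtain ⟨-, h⟩ := h
    by_cases hjl : j.val = l.val
    · rw [hjl]
      split_ifs <;> omega
    · have hc := hc (by omega)
      by_cases hij : i.val = j.val
      · rw [← hij] at hc
        split_ifs <;> omega
      · split_ifs <;> omega
  · rintro ⟨i, x⟩ ⟨j, y⟩ h
    have hx := x.isLt
    have hy := y.isLt
    by_cases hij : i.val = j.val
    · obtain rfl := Fin.ext hij
      simp only [cyclePathsDist, if_true] at h
      by_cases hxy : x.val < y.val
      · refine ⟨⟨i, ⟨y.val - 1, by omega⟩⟩, ?_, ?_⟩
        · rw [cyclePaths_adj]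
          dsimp only
          omega
        · simp only [cyclePathsDist, if_true]
          omega
      · refine ⟨⟨i, ⟨y.val + 1, by omega⟩⟩, ?_, ?_⟩
        · rw [cyclePaths_adj]
          dsimp only
          omega
        · simp only [cyclePathsDist, if_true]
          omega
    · by_cases hy0 : y.val = 0
      · obtain ⟨l, hl, hadj, hd⟩ := cyclicDist_descent i.isLt j.isLt hij
        refine ⟨⟨⟨l, hl⟩, ⟨0, Nat.succ_pos _⟩⟩, ?_, ?_⟩
        · have hne : l ≠ j.val := by
            rintro rfl
            omega
          rw [cyclePaths_adj]
          dsimp only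
          omega
        · have hself := cyclicDist_self r i.val
          simp only [cyclePathsDist, if_neg hij]
          split_ifs with hil
          · rw [← hil] at hd
            omega
          · omega
      · refine ⟨⟨j, ⟨y.val - 1, by omega⟩⟩, ?_, ?_⟩
        · rw [cyclePaths_adj]
          dsimp only
          omega
        · simp only [cyclePathsDist, if_neg hij]
          omega

theorem sum_fin_succ_cast (n : ℕ) : ∑ x : Fin (n + 1), (x.val : ℚ) = n * (n + 1) / 2 := by
  rw [Fin.sum_univ_eq_sum_range (fun x => (x : ℚ)) (n + 1)]
  induction n with
  | zero => simp
  | succ n ih =>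
    rw [sum_range_succ, ih]
    push_cast
    ring

/-- Twice the Wiener index of the path on `n + 1` vertices. -/
theorem sum_path_dist (n : ℕ) :
    ∑ x : Fin (n + 1), ∑ y : Fin (n + 1), (((x.val - y.val) + (y.val - x.val) : ℕ) : ℚ) =
      n * (n + 1) * (n + 2) / 3 := by
  induction n with
  | zero => simp
  | succ n ih =>
    have hlast : ∑ x : Fin (n + 1), ((n + 1 - x.val : ℕ) : ℚ) = (n + 1) * (n + 2) / 2 := by
      have : ∀ x : Fin (n + 1), ((n + 1 - x.val : ℕ) : ℚ) = (n + 1 : ℚ) - x.val := fun x => by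
        rw [Nat.cast_sub (by omega)]
        push_cast
        rfl
      simp only [this, sum_sub_distrib, sum_fin_succ_cast, sum_const, card_univ, Fintype.card_fin,
        nsmul_eq_mul]
      push_cast
      ring
    have hzero : ∀ x : Fin (n + 1), x.val - (n + 1) = 0 := fun x => by omega
    rw [Fin.sum_univ_castSucc]
    simp only [Fin.sum_univ_castSucc (n := n + 1), Fin.val_castSucc, Fin.val_last, sum_add_distrib,
      ih, hzero, zero_add, add_zero, hlast, Nat.sub_self, Nat.cast_zero]
    push_cast
    ring

/-- The sum of the distances between the vertices of two of the attached paths. -/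
theorem sum_cyclePathsDist (r : ℕ) (m : Fin r → ℕ) (i j : Fin r) :
    ∑ x : Fin (m i + 1), ∑ y : Fin (m j + 1), (cyclePathsDist r m ⟨i, x⟩ ⟨j, y⟩ : ℚ) =
      (m j + 1) * (m i * (m i + 1) / 2) + (m i + 1) * (m j * (m j + 1) / 2) +
        (m i + 1) * (m j + 1) * cyclicDist r i j +
        if i = j then -(m i * (m i + 1) * (2 * m i + 1) / 3 : ℚ) else 0 := by
  by_cases hij : i = j
  · subst hij
    simp only [cyclePathsDist, if_true, sum_path_dist, cyclicDist_self]
    push_cast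
    ring
  · have hval : i.val ≠ j.val := fun h => hij (Fin.ext h)
    simp only [cyclePathsDist, if_neg hval, if_neg hij, Nat.cast_add, sum_add_distrib, sum_const,
      card_univ, Fintype.card_fin, nsmul_eq_mul, sum_fin_succ_cast, ← mul_sum]
    push_cast
    ring

theorem wienerIndex_cyclePaths (r : ℕ) (m : Fin r → ℕ) :
    wienerIndex (cyclePaths r m) =
      ((∑ i, (m i + 1 : ℚ)) * (∑ i, (m i * (m i + 1) : ℚ)) +
        (∑ i, ∑ j, (m i + 1 : ℚ) * (m j + 1) * cyclicDist r i j) -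
        ∑ i, (m i * (m i + 1) * (2 * m i + 1) / 3 : ℚ)) / 2 := by
  unfold wienerIndex
  congr 1
  simp only [Fintype.sum_sigma, cyclePaths_dist]
  have hswap : ∀ i : Fin r, ∑ x : Fin (m i + 1), ∑ j : Fin r, ∑ y : Fin (m j + 1),
      (cyclePathsDist r m ⟨i, x⟩ ⟨j, y⟩ : ℚ) = ∑ j : Fin r, ∑ x : Fin (m i + 1),
        ∑ y : Fin (m j + 1), (cyclePathsDist r m ⟨i, x⟩ ⟨j, y⟩ : ℚ) := fun i => sum_comm
  simp only [hswap, sum_cyclePathsDist, sum_add_distrib, sum_ite_eq, mem_univ, if_true,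
    ← mul_sum, ← sum_mul, sum_neg_distrib, ← sum_div]
  ring

/-- Moving weight `a` from `k` to `t` in a symmetric quadratic form with zero diagonal. -/
theorem quadratic_form_transfer {ι : Type*} [Fintype ι] [DecidableEq ι] (c : ι → ι → ℚ)
    (hsymm : ∀ i j, c i j = c j i) (hdiag : ∀ i, c i i = 0) (p : ι → ℚ) (k t : ι) (a : ℚ) :
    ∑ i, ∑ j, (p i + a * ((if i = t then 1 else 0) - if i = k then 1 else 0)) *
        (p j + a * ((if j = t then 1 else 0) - if j = k then 1 else 0)) * c i j =
      (∑ i, ∑ j, p i * p j * c i j) +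
        2 * a * ∑ i, p i * (c i t - c i k) - 2 * a ^ 2 * c k t := by
  have hcomm : ∀ i, ∑ j, p j * c i j = ∑ j, p j * c j i := fun i =>
    sum_congr rfl fun j _ => by rw [hsymm]
  simp only [mul_assoc, ← mul_sum]
  simp only [add_mul, sum_add_distrib, mul_sub, sub_mul, sum_sub_distrib, mul_ite, mul_one,
    mul_zero, ite_mul, zero_mul, sum_ite_eq', mem_univ, if_true, mul_add, hdiag, hcomm, hsymm t k,
    mul_left_comm (p _) a, ← mul_sum]
  ring

/-- Merging two attached paths at `t` increases the Wiener index, if the other vertices are on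
the whole at least as close to `k` as to `t`. -/
theorem wienerIndex_cyclePaths_lt_merge (r : ℕ) (hr : 3 ≤ r) (m : Fin r → ℕ) (k t : Fin r)
    (hkt : k ≠ t) (hmk : 1 ≤ m k) (hmt : 1 ≤ m t)
    (h : (∑ i ∈ (univ.erase k).erase t, (m i + 1) * (cyclePaths r m).dist ⟨i, 0⟩ ⟨k, 0⟩) ≤
      ∑ i ∈ (univ.erase k).erase t, (m i + 1) * (cyclePaths r m).dist ⟨i, 0⟩ ⟨t, 0⟩) :
    wienerIndex (cyclePaths r m) <
      wienerIndex (cyclePaths r (Function.update (Function.update m k 0) t (m k + m t))) := by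
  have hsplit : ∀ f : Fin r → ℚ, ∑ i, f i = f k + f t + ∑ i ∈ (univ.erase k).erase t, f i := by
    intro f
    rw [← add_sum_erase _ f (mem_univ k),
      ← add_sum_erase _ f (mem_erase.2 ⟨hkt.symm, mem_univ t⟩), add_assoc]
  have hdist : ∀ i s : Fin r,
      (cyclePaths r m).dist ⟨i, 0⟩ ⟨s, 0⟩ = cyclicDist r i.val s.val := by
    intro i s
    rw [cyclePaths_dist]
    simp only [cyclePathsDist, Fin.val_zero]
    split_ifs with his
    · rw [his, cyclicDist_self]
    · simp
  simp only [hdist] at h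
  have hQ : (0 : ℚ) ≤ ∑ i ∈ (univ.erase k).erase t,
      (m i + 1 : ℚ) * ((cyclicDist r i t : ℚ) - cyclicDist r i k) := by
    simp only [mul_sub, sum_sub_distrib, sub_nonneg]
    exact_mod_cast h
  have hN : ((r : ℚ) - 2) ≤ ∑ i ∈ (univ.erase k).erase t, (m i + 1 : ℚ) := by
    have hcard : ((univ.erase k).erase t).card = r - 2 := by
      rw [card_erase_of_mem (mem_erase.2 ⟨hkt.symm, mem_univ t⟩), card_erase_of_mem (mem_univ k),
        card_univ, Fintype.card_fin]
      omega
    have := card_nsmul_le_sum ((univ.erase k).erase t) (fun i => (m i + 1 : ℚ)) 1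
      fun i _ => by simp
    rw [hcard, nsmul_eq_mul, Nat.cast_sub (by omega)] at this
    simpa using this
  have hd : (cyclicDist r k t : ℚ) ≤ r - 2 := by
    have : cyclicDist r k t + 2 ≤ r := by
      unfold cyclicDist
      omega
    rw [le_sub_iff_add_le]
    exact_mod_cast this
  set m' := Function.update (Function.update m k 0) t (m k + m t) with hm'
  have hk' : m' k = 0 := by simp [hm', hkt]
  have ht' : m' t = m k + m t := by simp [hm']
  have hoff : ∀ i ∈ (univ.erase k).erase t, m' i = m i := by
    intro i hi
    simp only [mem_erase] at hi
    simp [hm', hi.1, hi.2.1]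
  have hweight : ∀ i, (m' i + 1 : ℚ) =
      (m i + 1) + m k * ((if i = t then 1 else 0) - if i = k then 1 else 0) := by
    intro i
    by_cases hit : i = t
    · subst hit
      rw [ht', if_pos rfl, if_neg hkt.symm]
      push_cast
      ring
    · by_cases hik : i = k
      · subst hik
        rw [hk', if_pos rfl, if_neg hkt]
        push_cast
        ring
      · rw [hoff i (by simp [hit, hik]), if_neg hit, if_neg hik]
        ring
  have hquad : ∑ i, ∑ j, (m' i + 1 : ℚ) * (m' j + 1) * cyclicDist r i j =
      (∑ i, ∑ j, (m i + 1 : ℚ) * (m j + 1) * cyclicDist r i j) +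
        2 * m k * (∑ i, (m i + 1 : ℚ) * ((cyclicDist r i t : ℚ) - cyclicDist r i k)) -
        2 * (m k : ℚ) ^ 2 * cyclicDist r k t := by
    simp only [hweight]
    exact quadratic_form_transfer (fun i j : Fin r => (cyclicDist r i j : ℚ))
      (fun i j => by rw [cyclicDist_comm]) (fun i => by simp [cyclicDist_self])
      (fun i => (m i + 1 : ℚ)) k t (m k)
  have hoffsum : ∀ g : ℚ → ℚ, ∑ i ∈ (univ.erase k).erase t, g (m' i) =
      ∑ i ∈ (univ.erase k).erase t, g (m i) := fun g =>
    sum_congr rfl fun i hi => by rw [hoff i hi]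
  rw [wienerIndex_cyclePaths, wienerIndex_cyclePaths, hquad]
  rw [hsplit (fun i => (m' i + 1 : ℚ)), hsplit (fun i => (m' i * (m' i + 1) : ℚ)),
    hsplit (fun i => (m' i * (m' i + 1) * (2 * m' i + 1) / 3 : ℚ)),
    hsplit (fun i => (m i + 1 : ℚ)), hsplit (fun i => (m i * (m i + 1) : ℚ)),
    hsplit (fun i => (m i * (m i + 1) * (2 * m i + 1) / 3 : ℚ)),
    hsplit (fun i => (m i + 1 : ℚ) * ((cyclicDist r i t : ℚ) - cyclicDist r i k)),
    hoffsum (fun x => x + 1), hoffsum (fun x => x * (x + 1)),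
    hoffsum (fun x => x * (x + 1) * (2 * x + 1) / 3), hk', ht', cyclicDist_self, cyclicDist_self,
    cyclicDist_comm r t k]
  have ha : (1 : ℚ) ≤ m k := by exact_mod_cast hmk
  have hb : (1 : ℚ) ≤ m t := by exact_mod_cast hmt
  have hgap : (0 : ℚ) < (∑ i ∈ (univ.erase k).erase t, (m i + 1 : ℚ)) + 1 - cyclicDist r k t := by
    linarith
  have hmain := mul_pos (mul_pos (by linarith : (0 : ℚ) < m k) (by linarith : (0 : ℚ) < m t)) hgap
  have hrest := mul_nonneg (by linarith : (0 : ℚ) ≤ m k) hQ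
  push_cast
  linarith

/-- Shifting one of two nontrivial attached paths of
`C_r(P_{n_1+1}, …, P_{n_r+1})` onto the other strictly increases the Wiener index. -/
theorem wiener_cyclePaths_merge_paths
    (r : ℕ) (hr : 3 ≤ r) (m : Fin r → ℕ) (k t : Fin r) (hkt : k ≠ t)
    (hmk : 1 ≤ m k) (hmt : 1 ≤ m t) :
    ((∑ i ∈ (Finset.univ.erase k).erase t,
        (m i + 1) * (cyclePaths r m).dist ⟨i, 0⟩ ⟨k, 0⟩) ≤
      (∑ i ∈ (Finset.univ.erase k).erase t,
        (m i + 1) * (cyclePaths r m).dist ⟨i, 0⟩ ⟨t, 0⟩) →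
      wienerIndex (cyclePaths r m) <
        wienerIndex (cyclePaths r (Function.update (Function.update m k 0) t (m k + m t)))) ∧
    ((∑ i ∈ (Finset.univ.erase k).erase t,
        (m i + 1) * (cyclePaths r m).dist ⟨i, 0⟩ ⟨t, 0⟩) <
      (∑ i ∈ (Finset.univ.erase k).erase t,
        (m i + 1) * (cyclePaths r m).dist ⟨i, 0⟩ ⟨k, 0⟩) →
      wienerIndex (cyclePaths r m) <
        wienerIndex (cyclePaths r (Function.update (Function.update m t 0) k (m k + m t)))) := by
  refine ⟨wienerIndex_cyclePaths_lt_merge r hr m k t hkt hmk hmt, fun h => ?_⟩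
  rw [erase_right_comm] at h
  rw [Nat.add_comm (m k)]
  exact wienerIndex_cyclePaths_lt_merge r hr m t k hkt.symm hmt hmk h.le
end
end

section
/- Let G be an n-vertex unicyclic graph whose girth r is even and satisfies r ≥ 6. Then W(G) ≤ (n³ − 37n + 168)/6, with equality if and only if G is isomorphic to L_{n,6} when n ≠ 8, and G is isomorphic to L_{8,6} or to L_{8,8} when n = 8. -/
open SimpleGraph Finset
open scoped Classical

noncomputable section

universe u

section Distance

variable {V : Type u} {G : SimpleGraph V}

lemma le_add_dist_of_forall_adj (hG : G.Connected) {f : V → ℕ}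
    (hf : ∀ x y, G.Adj x y → f y ≤ f x + 1) (x y : V) : f y ≤ f x + G.dist x y := by
  obtain ⟨p, hp⟩ := hG.exists_walk_length_eq_dist x y
  rw [← hp]
  clear hp
  induction p with
  | nil => simp
  | cons h p ih =>
    have := hf _ _ h
    rw [Walk.length_cons]
    omega

lemma dist_le_dist_add_one (hG : G.Connected) {x y z : V} (h : G.Adj x y) :
    G.dist z y ≤ G.dist z x + 1 := by
  have h1 := hG.dist_triangle (u := z) (v := x) (w := y)
  rwa [dist_eq_one_iff_adj.mpr h] at h1

lemma exists_adj_dist_eq (hG : G.Connected) {v x : V} {m : ℕ} (h : G.dist v x = m + 1) :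
    ∃ y, G.Adj y x ∧ G.dist v y = m := by
  obtain ⟨p, hp⟩ := hG.exists_walk_length_eq_dist x v
  rw [dist_comm, h] at hp
  cases p with
  | nil => simp at hp
  | @cons _ y _ hxy q =>
    rw [Walk.length_cons] at hp
    have h1 := dist_le q
    rw [dist_comm] at h1
    have h2 := dist_le_dist_add_one hG (z := v) hxy.symm
    exact ⟨y, hxy.symm, by omega⟩

lemma dist_leaf (hG : G.Connected) {u w x : V} (hw : ∀ y, G.Adj w y ↔ y = u) (hx : x ≠ w) :
    G.dist w x = G.dist u x + 1 := by
  obtain ⟨m, hm⟩ := Nat.exists_eq_succ_of_ne_zero (hG.pos_dist_of_ne hx).ne'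
  obtain ⟨y, hy, hd⟩ := exists_adj_dist_eq hG hm
  have h1 := dist_le_dist_add_one hG (z := x) ((hw u).mpr rfl).symm
  rw [(hw y).mp hy.symm] at hd
  rw [dist_comm (u := x), dist_comm (u := x)] at h1
  rw [dist_comm] at hm
  rw [dist_comm] at hd
  omega

lemma dist_induce_compl_leaf (hG : G.Connected) {u w : V} (hw : ∀ y, G.Adj w y ↔ y = u)
    (hG' : (G.induce {w}ᶜ).Connected) (x y : ({w}ᶜ : Set V)) :
    (G.induce {w}ᶜ).dist x y = G.dist x y := by
  apply le_antisymm
  · have huw : u ∈ ({w}ᶜ : Set V) := ((hw u).mpr rfl).ne'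
    let f : V → ℕ := fun z =>
      if hz : z ∈ ({w}ᶜ : Set V) then (G.induce {w}ᶜ).dist x ⟨z, hz⟩
      else (G.induce {w}ᶜ).dist x ⟨u, huw⟩
    have hf : ∀ a b, G.Adj a b → f b ≤ f a + 1 := by
      intro a b hab
      by_cases ha : a ∈ ({w}ᶜ : Set V) <;> by_cases hb : b ∈ ({w}ᶜ : Set V)
      · simp only [f, dif_pos ha, dif_pos hb]
        exact dist_le_dist_add_one hG' (by simpa using hab)
      · have hbw : b = w := by simpa using hb
        have hau : a = u := (hw a).mp (hbw ▸ hab.symm)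
        subst hau
        simp [f, hb, huw, -Set.mem_compl_iff]
      · have haw : a = w := by simpa using ha
        have hbu : b = u := (hw b).mp (haw ▸ hab)
        subst hbu
        simp [f, ha, huw, -Set.mem_compl_iff]
      · simp [f, ha, hb, -Set.mem_compl_iff]
    have := le_add_dist_of_forall_adj hG hf x y
    simpa [f, x.2, y.2, -Set.mem_compl_iff] using this
  · refine le_of_le_of_eq (le_add_dist_of_forall_adj hG' (f := fun z => G.dist x z) ?_ x y) ?_
    · intro a b hab
      exact dist_le_dist_add_one hG (by simpa using hab)
    · simp

lemma sum_dist_leaf [Fintype V] (hG : G.Connected) {u w : V} (hw : ∀ y, G.Adj w y ↔ y = u)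
    (hG' : (G.induce {w}ᶜ).Connected) :
    ∑ x, ∑ y, G.dist x y =
      ∑ x, ∑ y, (G.induce {w}ᶜ).dist x y + 2 * ∑ y, G.dist w y := by
  have key : ∀ f : V → ℕ, ∑ x, f x = f w + ∑ x : ({w}ᶜ : Set V), f x := by
    intro f
    rw [Fintype.sum_eq_add_sum_compl w f]
    congr 1
    exact Finset.sum_subtype _ (by simp) f
  simp_rw [dist_induce_compl_leaf hG hw hG']
  rw [key (fun x => ∑ y, G.dist x y), key (fun y => G.dist w y)]
  simp_rw [key (fun y => G.dist _ y), Finset.sum_add_distrib]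
  simp only [dist_self, dist_comm (v := w)]
  ring

end Distance

section LayerSums

variable {α : Type*}

lemma lt_card_of_layers {S : Finset α} {d : α → ℕ}
    (hd : ∀ x ∈ S, ∀ m, d x = m + 1 → ∃ y ∈ S, d y = m) {x : α} (hx : x ∈ S) :
    d x < S.card := by
  have key : ∀ k ≤ d x, ∃ y ∈ S, d y = d x - k := by
    intro k
    induction k with
    | zero => exact fun _ => ⟨x, hx, rfl⟩
    | succ k ih =>
      intro hk
      obtain ⟨y, hy, hyd⟩ := ih (by omega)
      exact hd y hy _ (by omega)
  have hsub : Finset.range (d x + 1) ⊆ S.image d := by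
    intro j hj
    obtain ⟨y, hy, hyd⟩ := key (d x - j) (by omega)
    exact Finset.mem_image.mpr ⟨y, hy, by have := Finset.mem_range.mp hj; omega⟩
  have := (Finset.card_le_card hsub).trans Finset.card_image_le
  rwa [Finset.card_range] at this

lemma two_mul_sum_layers_le {S : Finset α} {d : α → ℕ}
    (hd : ∀ x ∈ S, ∀ m, d x = m + 1 → ∃ y ∈ S, d y = m) :
    2 * ∑ x ∈ S, d x ≤ S.card * (S.card - 1) ∧
      (2 * ∑ x ∈ S, d x = S.card * (S.card - 1) → S.image d = Finset.range S.card) := by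
  obtain ⟨m, hm⟩ : ∃ m, m = S.card := ⟨_, rfl⟩
  induction m generalizing S with
  | zero =>
    obtain rfl := Finset.card_eq_zero.mp hm.symm
    simp
  | succ m ih =>
    have hne : S.Nonempty := Finset.card_pos.mp (by omega)
    obtain ⟨x, hx, hmax⟩ := S.exists_max_image d hne
    have hlt := lt_card_of_layers hd hx
    have hc : (S.erase x).card = m := by rw [Finset.card_erase_of_mem hx]; omega
    obtain ⟨h1, h2⟩ := ih (S := S.erase x) (by
      intro y hy k hk
      obtain ⟨z, hz, hzd⟩ := hd y (Finset.mem_of_mem_erase hy) k hk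
      refine ⟨z, Finset.mem_erase.mpr ⟨?_, hz⟩, hzd⟩
      rintro rfl
      have := hmax y (Finset.mem_of_mem_erase hy)
      omega) hc.symm
    rw [← hm] at hlt ⊢
    rw [hc] at h1 h2
    rw [← Finset.add_sum_erase S d hx]
    have hmm : (m + 1) * (m + 1 - 1) = m * (m - 1) + 2 * m := by
      cases m with
      | zero => rfl
      | succ k => simp only [Nat.add_sub_cancel]; ring
    refine ⟨by omega, fun h => ?_⟩
    have hdx : d x = m := by omega
    rw [← Finset.insert_erase hx, Finset.image_insert, h2 (by omega), hdx,
      Finset.range_add_one]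

end LayerSums

/-- `c` runs periodically around a cycle of length `r` in `G`. -/
structure IsCycleParam {V : Type*} (G : SimpleGraph V) (r : ℕ) (c : ℕ → V) : Prop where
  adj : ∀ i, G.Adj (c i) (c (i + 1))
  period : ∀ i, c (i + r) = c i
  modEq : ∀ i j, c i = c j → i ≡ j [MOD r]

namespace IsCycleParam

variable {V : Type u} {G : SimpleGraph V} {r : ℕ} {c : ℕ → V}

lemma shift (hc : IsCycleParam G r c) (k : ℕ) : IsCycleParam G r (fun i => c (k + i)) where
  adj i := hc.adj (k + i)
  period i := by rw [← Nat.add_assoc, hc.period]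
  modEq i j h := Nat.ModEq.add_left_cancel' k (hc.modEq _ _ h)

lemma injOn (hc : IsCycleParam G r c) {i j : ℕ} (hi : i < r) (hj : j < r) (h : c i = c j) :
    i = j :=
  (hc.modEq i j h).eq_of_lt_of_lt hi hj

lemma apply_mod (hc : IsCycleParam G r c) (i : ℕ) : c (i % r) = c i := by
  have : ∀ k m, c (m + r * k) = c m := by
    intro k
    induction k with
    | zero => simp
    | succ k ih => intro m; rw [Nat.mul_succ, ← Nat.add_assoc, hc.period, ih]
  conv_rhs => rw [← Nat.mod_add_div i r]
  rw [this]

lemma adj_pred (hc : IsCycleParam G r c) (hr : 3 ≤ r) (i : ℕ) :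
    G.Adj (c i) (c (i + (r - 1))) := by
  have := hc.adj (i + (r - 1))
  rw [show i + (r - 1) + 1 = i + r by omega, hc.period] at this
  exact this.symm

lemma succ_ne_pred (hc : IsCycleParam G r c) (hr : 3 ≤ r) (i : ℕ) :
    c (i + 1) ≠ c (i + (r - 1)) := by
  intro h
  have := (hc.shift i).injOn (i := 1) (j := r - 1) (by omega) (by omega) h
  omega

lemma ne_leaf (hc : IsCycleParam G r c) (hr : 3 ≤ r) {u w : V} (hw : ∀ y, G.Adj w y ↔ y = u)
    (i : ℕ) : c i ≠ w := by
  rintro rfl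
  exact hc.succ_ne_pred hr i
    (((hw _).mp (hc.adj i)).trans ((hw _).mp (hc.adj_pred hr i)).symm)

lemma induce (hc : IsCycleParam G r c) {s : Set V} (hs : ∀ i, c i ∈ s) :
    IsCycleParam (G.induce s) r (fun i => ⟨c i, hs i⟩) where
  adj i := hc.adj i
  period i := Subtype.ext (hc.period i)
  modEq i j h := hc.modEq i j (congrArg Subtype.val h)

lemma exists_leaf_or_surjective [Fintype V] (hc : IsCycleParam G r c) (hr : 3 ≤ r)
    (hG : G.Connected) (hE : G.edgeSet.ncard = Fintype.card V) :
    (∃ w u, ∀ y, G.Adj w y ↔ y = u) ∨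
      (Function.Surjective c ∧ ∀ i y, G.Adj (c i) y → y = c (i + 1) ∨ y = c (i + (r - 1))) := by
  by_cases hleaf : ∃ w, G.degree w = 1
  · obtain ⟨w, hw⟩ := hleaf
    obtain ⟨u, hu, huu⟩ := degree_eq_one_iff_existsUnique_adj.mp hw
    exact Or.inl ⟨w, u, fun y => ⟨huu y, by rintro rfl; exact hu⟩⟩
  right
  push Not at hleaf
  have : Nontrivial V := ⟨c 0, c 1, (hc.adj 0).ne⟩
  have hdeg : ∀ x, 2 ≤ G.degree x := by
    intro x
    have h1 := hG.preconnected.degree_pos_of_nontrivial x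
    have h2 := hleaf x
    omega
  have hsum := G.sum_degrees_eq_twice_card_edges
  rw [← Set.ncard_coe_finset, coe_edgeFinset, hE] at hsum
  have hdeg2 : ∀ x, G.degree x = 2 := by
    have h1 : ∑ x : V, 2 = ∑ x, G.degree x := by
      rw [hsum]; simp [mul_comm]
    have h2 := (Finset.sum_eq_sum_iff_of_le (fun x _ => hdeg x)).mp h1
    exact fun x => (h2 x (Finset.mem_univ x)).symm
  have hnb : ∀ i y, G.Adj (c i) y → y = c (i + 1) ∨ y = c (i + (r - 1)) := by
    intro i y hy
    have hsub : ({c (i + 1), c (i + (r - 1))} : Finset V) ⊆ G.neighborFinset (c i) := by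
      intro z hz
      rw [mem_neighborFinset]
      rcases Finset.mem_insert.mp hz with rfl | hz
      · exact hc.adj i
      · rw [Finset.mem_singleton.mp hz]; exact hc.adj_pred hr i
    have heq := Finset.eq_of_subset_of_card_le hsub (by
      rw [Finset.card_pair (hc.succ_ne_pred hr i), card_neighborFinset_eq_degree, hdeg2])
    have hmem : y ∈ ({c (i + 1), c (i + (r - 1))} : Finset V) := by
      rw [heq, mem_neighborFinset]; exact hy
    simpa using hmem
  refine ⟨fun x => ?_, hnb⟩
  obtain ⟨p⟩ := hG.preconnected (c 0) x
  have key : ∀ {a b : V}, G.Walk a b → (∃ i, c i = a) → ∃ i, c i = b := by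
    intro a b p
    induction p with
    | nil => exact id
    | cons h p ih =>
      rintro ⟨i, rfl⟩
      rcases hnb i _ h with h | h
      · exact ih ⟨_, h.symm⟩
      · exact ih ⟨_, h.symm⟩
  exact key p ⟨0, rfl⟩

end IsCycleParam

lemma connected_and_ncard_edgeSet_induce_compl_leaf {V : Type u} [Fintype V] {G : SimpleGraph V}
    (hG : G.Connected) (hE : G.edgeSet.ncard = Fintype.card V) {u w : V}
    (hw : ∀ y, G.Adj w y ↔ y = u) :
    (G.induce {w}ᶜ).Connected ∧
      (G.induce {w}ᶜ).edgeSet.ncard = Fintype.card ({w}ᶜ : Set V) ∧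
      Fintype.card ({w}ᶜ : Set V) + 1 = Fintype.card V := by
  have hdeg : G.degree w = 1 :=
    degree_eq_one_iff_existsUnique_adj.mpr ⟨u, (hw u).mpr rfl, fun y => (hw y).mp⟩
  have hcard : Fintype.card ({w}ᶜ : Set V) + 1 = Fintype.card V := by
    have := Fintype.card_pos_iff.mpr ⟨w⟩
    rw [Fintype.card_compl_set]
    simp
    omega
  refine ⟨hG.induce_compl_singleton_of_degree_eq_one hdeg, ?_, hcard⟩
  have h1 := G.card_edgeFinset_induce_compl_singleton w
  rw [card_edgeFinset_deleteIncidenceSet, hdeg, ← Set.ncard_coe_finset, ← Set.ncard_coe_finset,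
    coe_edgeFinset, coe_edgeFinset, hE] at h1
  omega

/-- Every vertex sees the cycle of a unicyclic graph from a single entry vertex. -/
lemma IsCycleParam.exists_dist_eq {V : Type u} [Fintype V] {G : SimpleGraph V} {r : ℕ}
    {c : ℕ → V} (hc : IsCycleParam G r c) (hr : 3 ≤ r) (hG : G.Connected)
    (hE : G.edgeSet.ncard = Fintype.card V) (v : V) :
    ∃ k a, ∀ i ≤ r, G.dist v (c (k + i)) = a + min i (r - i) := by
  obtain ⟨n, hn⟩ : ∃ n, n = Fintype.card V := ⟨_, rfl⟩
  induction n generalizing V with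
  | zero => exact absurd (Fintype.card_pos_iff.mpr ⟨v⟩) (by omega)
  | succ n ih =>
    rcases hc.exists_leaf_or_surjective hr hG hE with ⟨w, u, hw⟩ | ⟨hsurj, hnb⟩
    · obtain ⟨hG', hE', hcard⟩ := connected_and_ncard_edgeSet_induce_compl_leaf hG hE hw
      have hcw := hc.ne_leaf hr hw
      have key : ∀ x ≠ w, ∃ k a, ∀ i ≤ r, G.dist x (c (k + i)) = a + min i (r - i) := by
        intro x hx
        obtain ⟨k, a, h⟩ := ih (hc.induce (s := {w}ᶜ) hcw) hG' hE' ⟨x, hx⟩ (by omega)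
        refine ⟨k, a, fun i hi => ?_⟩
        rw [← h i hi, dist_induce_compl_leaf hG hw hG']
      by_cases hv : v = w
      · obtain ⟨k, a, h⟩ := key u ((hw u).mpr rfl).ne'
        refine ⟨k, a + 1, fun i hi => ?_⟩
        rw [hv, dist_leaf hG hw (hcw _), h i hi]
        omega
      · exact key v hv
    · obtain ⟨k, rfl⟩ := hsurj v
      refine ⟨k, 0, ?_⟩
      have hcs := hc.shift k
      have hex : ∀ x, ∃ i < r, c (k + i) = x := by
        intro x
        obtain ⟨j, rfl⟩ := hsurj x
        refine ⟨(j + (r - 1) * k) % r, Nat.mod_lt _ (by omega), ?_⟩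
        rw [hcs.apply_mod, ← hc.apply_mod, ← hc.apply_mod j]
        congr 1
        rw [show k + (j + (r - 1) * k) = j + r * k by
          obtain ⟨s, rfl⟩ : ∃ s, r = s + 1 := ⟨r - 1, by omega⟩
          simp only [Nat.add_sub_cancel]; ring]
        simp
      choose idx hidx hcidx using hex
      have hlow : ∀ a b, G.Adj a b →
          min (idx b) (r - idx b) ≤ min (idx a) (r - idx a) + 1 := by
        intro a b hab
        have hia := hidx a
        have hib := hidx b
        rw [← hcidx a] at hab
        rcases hnb _ _ hab with h | h
        · rw [← hcidx b] at h
          rcases Nat.lt_or_ge (idx a + 1) r with h1 | h1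
          · have := hcs.injOn hib h1 h
            omega
          · have := hcs.injOn hib (j := 0) (by omega) (by
              rw [h, ← hcs.period 0]
              congr 1
              omega)
            omega
        · rw [← hcidx b] at h
          rcases Nat.eq_zero_or_pos (idx a) with h1 | h1
          · have := hcs.injOn hib (j := r - 1) (by omega) (by rw [h, h1]; rfl)
            omega
          · have := hcs.injOn hib (j := idx a - 1) (by omega) (by
              rw [h, ← hcs.period (idx a - 1)]
              congr 1
              omega)
            omega
      have hidx' : ∀ i < r, idx (c (k + i)) = i := fun i hi =>
        hcs.injOn (hidx _) hi (hcidx _)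
      have hup : ∀ i j, G.dist (c (k + i)) (c (k + (i + j))) ≤ j := by
        intro i j
        induction j with
        | zero => simp
        | succ j ihj =>
          have := dist_le_dist_add_one hG (z := c (k + i)) (hcs.adj (i + j))
          exact this.trans (by omega)
      intro i hi
      have h0 : c (k + r) = c k := hc.period k
      rcases hi.lt_or_eq with hi | rfl
      · have h1 := le_add_dist_of_forall_adj hG hlow (c k) (c (k + i))
        rw [hidx' i hi, show idx (c k) = 0 from hidx' 0 (by omega)] at h1
        have h2 := hup 0 i
        have h3 := hup i (r - i)
        rw [Nat.add_sub_cancel' hi.le, h0, SimpleGraph.dist_comm] at h3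
        simp only [Nat.zero_add, Nat.add_zero] at h2
        omega
      · rw [h0]
        simp

section Lollipop

lemma nonempty_iso_of_bijective {V : Type*} {W : Type*} [Finite V]
    {H : SimpleGraph W} {G : SimpleGraph V} {f : W → V} (hf : Function.Bijective f)
    (hadj : ∀ x y, H.Adj x y → G.Adj (f x) (f y)) (hE : G.edgeSet.ncard ≤ H.edgeSet.ncard) :
    Nonempty (G ≃g H) := by
  have hinj := Sym2.map.injective hf.injective
  have hsub : Sym2.map f '' H.edgeSet ⊆ G.edgeSet := by
    rintro _ ⟨e, he, rfl⟩
    induction e with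
    | _ x y => exact hadj x y he
  have heq := Set.eq_of_subset_of_ncard_le hsub
    (by rwa [Set.ncard_image_of_injective _ hinj]) (Set.toFinite _)
  refine ⟨(RelIso.symm ⟨Equiv.ofBijective f hf, ?_⟩ : G ≃g H)⟩
  intro x y
  refine ⟨fun h => ?_, hadj x y⟩
  have hmem : s(f x, f y) ∈ Sym2.map f '' H.edgeSet := by
    rw [heq]
    exact h
  obtain ⟨e, he, hxy⟩ := hmem
  have : e = s(x, y) := hinj hxy
  rwa [this] at he

lemma le_ncard_edgeSet_lollipop {n r : ℕ} (hr : 3 ≤ r) (hrn : r ≤ n) :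
    n ≤ (lollipop n r).edgeSet.ncard := by
  let g : Fin n → Sym2 (Fin n) := fun i =>
    if h : i.val + 1 < n then s(i, ⟨i.val + 1, h⟩)
    else s(⟨0, by omega⟩, ⟨r - 1, by omega⟩)
  have hg : Function.Injective g := by
    intro i j hij
    have hi := i.2
    have hj := j.2
    simp only [g] at hij
    split_ifs at hij <;> simp [Fin.ext_iff] at hij ⊢ <;> omega
  have hsub : Set.range g ⊆ (lollipop n r).edgeSet := by
    rintro _ ⟨i, rfl⟩
    simp only [g]
    split_ifs
    · simp [lollipop, Fin.ext_iff]
    · simp [lollipop, Fin.ext_iff]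
      omega
  have := Set.ncard_le_ncard hsub (Set.toFinite _)
  rwa [← Set.image_univ, Set.ncard_image_of_injective _ hg, Set.ncard_univ, Nat.card_fin] at this

/-- The distance between `i` and `j` in the path `0, 1, 2, …` with the chord `{0, r - 1}`. -/
def chordDist (r i j : ℕ) : ℕ :=
  min ((i - j) + (j - i)) (min (1 + i + ((j - (r - 1)) + (r - 1 - j)))
    (1 + j + ((i - (r - 1)) + (r - 1 - i))))

lemma chordDist_le_add_one {r i j k : ℕ}
    (h : j + 1 = k ∨ k + 1 = j ∨ (j = 0 ∧ k = r - 1) ∨ (k = 0 ∧ j = r - 1)) :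
    chordDist r i k ≤ chordDist r i j + 1 := by
  unfold chordDist
  generalize r - 1 = s at *
  rw [← min_add_add_right, ← min_add_add_right, le_min_iff, le_min_iff]
  rcases h with rfl | rfl | ⟨rfl, rfl⟩ | ⟨rfl, rfl⟩
  all_goals refine ⟨?_, ?_, ?_⟩ <;> omega

lemma sum_chordDist_le {V : Type*} [Fintype V] {G : SimpleGraph V} (hG : G.Connected) {n r : ℕ}
    (e : G ≃g lollipop n r) :
    ∑ i ∈ Finset.range n, ∑ j ∈ Finset.range n, chordDist r i j ≤ ∑ x, ∑ y, G.dist x y := by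
  simp_rw [Finset.sum_range]
  rw [← e.toEquiv.sum_comp]
  refine Finset.sum_le_sum fun x _ => ?_
  rw [← e.toEquiv.sum_comp]
  refine Finset.sum_le_sum fun y _ => ?_
  have := le_add_dist_of_forall_adj hG (f := fun z => chordDist r (e x).val (e z).val) (by
    intro a b hab
    have h := e.map_rel_iff.mpr hab
    simp only [lollipop, fromRel_adj] at h
    exact chordDist_le_add_one (by tauto)) x y
  simpa [chordDist] using this

lemma two_mul_sum_chordDist_six {n : ℕ} (hn : 6 ≤ n) :
    2 * ∑ i ∈ Finset.range n, chordDist 6 i n + 12 = n * (n + 1) := by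
  induction n, hn using Nat.le_induction with
  | base => decide
  | succ n hn ih =>
    have h : ∑ i ∈ Finset.range n, chordDist 6 i (n + 1) =
        ∑ i ∈ Finset.range n, (chordDist 6 i n + 1) := by
      refine Finset.sum_congr rfl fun i hi => ?_
      have := Finset.mem_range.mp hi
      simp only [chordDist]
      omega
    have h1 : chordDist 6 n (n + 1) = 1 := by
      simp only [chordDist]
      omega
    rw [Finset.sum_range_succ, h, Finset.sum_add_distrib, h1]
    simp only [Finset.sum_const, Finset.card_range, smul_eq_mul, mul_one]
    nlinarith

lemma three_mul_sum_sum_chordDist_six {n : ℕ} (hn : 6 ≤ n) :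
    3 * ∑ i ∈ Finset.range n, ∑ j ∈ Finset.range n, chordDist 6 i j + 37 * n = n ^ 3 + 168 := by
  induction n, hn using Nat.le_induction with
  | base => decide
  | succ n hn ih =>
    have h1 : ∀ i, chordDist 6 n i = chordDist 6 i n := by
      intro i
      simp only [chordDist]
      omega
    have h2 : chordDist 6 n n = 0 := by simp [chordDist]
    have h3 := two_mul_sum_chordDist_six hn
    simp_rw [Finset.sum_range_succ, Finset.sum_add_distrib, h1, h2]
    nlinarith

end Lollipop

section Unicyclic

variable {V : Type u} [Fintype V] {G : SimpleGraph V} {r : ℕ} {c : ℕ → V}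

lemma IsCycleParam.nonempty_iso_lollipop (hc : IsCycleParam G r c) (hr : 3 ≤ r)
    (hsurj : Function.Surjective c) (hE : G.edgeSet.ncard = Fintype.card V) :
    Fintype.card V = r ∧ Nonempty (G ≃g lollipop r r) := by
  have hbij : Function.Bijective (fun i : Fin r => c i) := by
    constructor
    · intro i j hij
      exact Fin.ext (hc.injOn i.2 j.2 hij)
    · intro x
      obtain ⟨j, rfl⟩ := hsurj x
      exact ⟨⟨j % r, Nat.mod_lt _ (by omega)⟩, hc.apply_mod j⟩
  have hcard : Fintype.card V = r := by
    rw [← Fintype.card_of_bijective hbij, Fintype.card_fin]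
  refine ⟨hcard, nonempty_iso_of_bijective hbij ?_
    (by rw [hE, hcard]; exact le_ncard_edgeSet_lollipop hr le_rfl)⟩
  have key : ∀ i j : Fin r, (i.val + 1 = j.val ∨ i.val = 0 ∧ j.val = r - 1) →
      G.Adj (c i) (c j) := by
    rintro i j (h | ⟨h0, h1⟩)
    · rw [← h]
      exact hc.adj i
    · have := hc.adj_pred hr 0
      rwa [Nat.zero_add, ← h0, ← h1] at this
  intro i j hij
  rw [lollipop, fromRel_adj] at hij
  rcases hij.2 with h | h
  · exact key i j h
  · exact (key j i h).symm

lemma IsCycleParam.four_mul_sum_dist (hc : IsCycleParam G r c) (hr : 3 ≤ r) (hre : Even r)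
    (hG : G.Connected) (hE : G.edgeSet.ncard = Fintype.card V)
    (hsurj : Function.Surjective c) : 4 * ∑ x, ∑ y, G.dist x y = r ^ 3 := by
  have hcard := (hc.nonempty_iso_lollipop hr hsurj hE).1
  have hD : ∀ v, 4 * ∑ y, G.dist v y = r ^ 2 := by
    intro v
    obtain ⟨k, a, h⟩ := hc.exists_dist_eq hr hG hE v
    have hcs := hc.shift k
    have hinj : Function.Injective (fun i : Fin r => c (k + i)) :=
      fun i j hij => Fin.ext (hcs.injOn i.2 j.2 hij)
    have hbij : Function.Bijective (fun i : Fin r => c (k + i)) :=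
      (Fintype.bijective_iff_injective_and_card _).mpr ⟨hinj, by simp [hcard]⟩
    have ha : a = 0 := by
      obtain ⟨i, hi⟩ := hbij.2 v
      have h1 := h i i.2.le
      have hi' : c (k + i) = v := hi
      rw [hi', SimpleGraph.dist_self] at h1
      omega
    have hsum : ∑ y, G.dist v y = ∑ i ∈ Finset.range r, min i (r - i) := by
      rw [← (Equiv.ofBijective _ hbij).sum_comp, Finset.sum_range]
      refine Finset.sum_congr rfl fun i _ => ?_
      simp only [Equiv.ofBijective_apply]
      rw [h i i.2.le, ha, Nat.zero_add]
    obtain ⟨m, rfl⟩ := hre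
    rw [hsum]
    have key : ∀ m : ℕ, ∑ i ∈ Finset.range (m + m), min i (m + m - i) = m ^ 2 := by
      intro m
      rw [Finset.sum_range_add]
      have h1 : ∑ i ∈ Finset.range m, min i (m + m - i) = ∑ i ∈ Finset.range m, i :=
        Finset.sum_congr rfl fun i hi => by have := Finset.mem_range.mp hi; omega
      have h2 : ∑ i ∈ Finset.range m, min (m + i) (m + m - (m + i)) =
          ∑ i ∈ Finset.range m, (m - i) :=
        Finset.sum_congr rfl fun i hi => by have := Finset.mem_range.mp hi; omega
      rw [h1, h2, ← Finset.sum_add_distrib]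
      have h3 : ∑ i ∈ Finset.range m, (i + (m - i)) = ∑ i ∈ Finset.range m, m :=
        Finset.sum_congr rfl fun i hi => by have := Finset.mem_range.mp hi; omega
      rw [h3]
      simp [sq]
    rw [key]
    ring
  rw [Finset.mul_sum, Finset.sum_congr rfl fun x _ => hD x]
  simp [hcard]
  ring

/-- Every vertex has transmission at most that of the end-vertex of `L_{n,6}`. -/
lemma IsCycleParam.two_mul_transmission_le (hc : IsCycleParam G r c) (hr : 6 ≤ r) (hre : Even r)
    (hG : G.Connected) (hE : G.edgeSet.ncard = Fintype.card V) (v : V) :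
    2 * ∑ y, G.dist v y + 12 ≤ Fintype.card V * (Fintype.card V - 1) ∧
      (2 * ∑ y, G.dist v y + 12 = Fintype.card V * (Fintype.card V - 1) →
        Nonempty (G ≃g lollipop (Fintype.card V) 6)) := by
  obtain ⟨k, a, hk⟩ := hc.exists_dist_eq (by omega) hG hE v
  obtain ⟨b, hb, hdist⟩ : ∃ b, IsCycleParam G r b ∧
      ∀ i ≤ r, G.dist v (b i) = a + min i (r - i) := ⟨_, hc.shift k, hk⟩
  clear hk hc
  obtain ⟨n, hn⟩ : ∃ n, Fintype.card V = n := ⟨_, rfl⟩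
  rw [hn] at hE ⊢
  have hne : b (r - 1) ≠ b (r - 2) := fun h => by
    have := hb.injOn (by omega) (by omega) h
    omega
  let S : Finset V := (Finset.univ.erase (b (r - 1))).erase (b (r - 2))
  have hmem : ∀ x, x ∈ S ↔ x ≠ b (r - 2) ∧ x ≠ b (r - 1) := by simp [S]
  have hbS : ∀ i < r - 2, b i ∈ S := fun i hi => (hmem _).mpr
    ⟨fun h => by have := hb.injOn (by omega) (by omega) h; omega,
      fun h => by have := hb.injOn (by omega) (by omega) h; omega⟩
  have hScard : S.card + 2 = n := by
    have h1 := Finset.card_erase_add_one (Finset.mem_univ (b (r - 1)))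
    have h2 := Finset.card_erase_add_one
      (Finset.mem_erase.mpr ⟨hne.symm, Finset.mem_univ (b (r - 2))⟩)
    rw [Finset.card_univ, hn] at h1
    change ((Finset.univ.erase (b (r - 1))).erase (b (r - 2))).card + 2 = n
    omega
  have hsum : ∑ y, G.dist v y = ∑ y ∈ S, G.dist v y + (2 * a + 3) := by
    rw [← Finset.add_sum_erase _ _ (Finset.mem_univ (b (r - 1))),
      ← Finset.add_sum_erase _ _ (Finset.mem_erase.mpr ⟨hne.symm, Finset.mem_univ (b (r - 2))⟩),
      hdist (r - 1) (by omega), hdist (r - 2) (by omega)]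
    change _ = ∑ y ∈ (Finset.univ.erase (b (r - 1))).erase (b (r - 2)), G.dist v y + _
    omega
  have hlayers : ∀ x ∈ S, ∀ m, G.dist v x = m + 1 → ∃ y ∈ S, G.dist v y = m := by
    intro x hx m hm
    obtain ⟨y, -, hy⟩ := exists_adj_dist_eq hG hm
    by_cases hyS : y ∈ S
    · exact ⟨y, hyS, hy⟩
    · rw [hmem, not_and_or, not_not, not_not] at hyS
      rcases hyS with rfl | rfl
      · rw [hdist _ (by omega)] at hy
        exact ⟨b 2, hbS 2 (by omega), by rw [hdist _ (by omega)]; omega⟩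
      · rw [hdist _ (by omega)] at hy
        exact ⟨b 1, hbS 1 (by omega), by rw [hdist _ (by omega)]; omega⟩
  obtain ⟨hle, heq⟩ := two_mul_sum_layers_le hlayers
  have hlt : ∀ x ∈ S, G.dist v x < S.card := fun x hx => lt_card_of_layers hlayers hx
  have ha := hlt _ (hbS 3 (by omega))
  rw [hdist 3 (by omega)] at ha
  obtain ⟨t, ht⟩ : ∃ t, S.card = t + 4 := ⟨S.card - 4, by omega⟩
  have hnt : n = t + 6 := by omega
  have hprod : n * (n - 1) = S.card * (S.card - 1) + (4 * t + 18) := by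
    rw [hnt, ht, show t + 6 - 1 = t + 5 by omega, show t + 4 - 1 = t + 3 by omega]
    ring
  rw [hsum, hprod]
  refine ⟨by omega, fun h => ?_⟩
  have hat : a = t := by omega
  have himage := heq (by omega)
  have hr6 : r = 6 := by
    by_contra hr6
    have h4 := hlt _ (hbS 4 (by omega))
    rw [hdist 4 (by omega)] at h4
    obtain ⟨m, rfl⟩ := hre
    omega
  subst hr6
  have hinj : ∀ x ∈ S, ∀ y ∈ S, G.dist v x = G.dist v y → x = y := by
    have := Finset.injOn_of_card_image_eq (s := S) (f := G.dist v)
      (by rw [himage, Finset.card_range])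
    exact fun x hx y hy hxy => this hx hy hxy
  have hSmall : ∀ x, G.dist v x ≤ a → x ∈ S := by
    intro x hx
    rw [hmem]
    constructor
    · rintro rfl
      rw [hdist _ (by omega)] at hx
      omega
    · rintro rfl
      rw [hdist _ (by omega)] at hx
      omega
  have hex : ∀ j, ∃ x, j ≤ a → x ∈ S ∧ G.dist v x = j := by
    intro j
    by_cases hj : j ≤ a
    · have : j ∈ S.image (G.dist v) := by
        rw [himage, Finset.mem_range]
        omega
      obtain ⟨x, hx, hxj⟩ := Finset.mem_image.mp this
      exact ⟨x, fun _ => ⟨hx, hxj⟩⟩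
    · exact ⟨v, fun h => absurd h hj⟩
  choose p hp using hex
  have hpadj : ∀ j, j + 1 ≤ a → G.Adj (p (j + 1)) (p j) := by
    intro j hj
    obtain ⟨y, hy, hyd⟩ := exists_adj_dist_eq hG (hp (j + 1) hj).2
    have hyp : y = p j := hinj _ (hSmall y (by omega)) _ (hp j (by omega)).1
      (by rw [hyd, (hp j (by omega)).2])
    exact (hyp ▸ hy).symm
  have hb6 : b 6 = b 0 := hb.period 0
  have hd0 : G.dist v (b 0) = a := by rw [hdist _ (by omega)]; omega
  have hpa : p a = b 0 := hinj _ (hp a le_rfl).1 _ (hbS 0 (by omega))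
    (by rw [(hp a le_rfl).2, hd0])
  let f : Fin n → V := fun i => if i.val < 5 then b (i.val + 1) else p (n - 1 - i.val)
  have hf5 : ∀ i : Fin n, i.val ≤ 5 → f i = b (i.val + 1) := by
    intro i hi
    by_cases h5 : i.val < 5
    · exact if_pos h5
    · have h5 : i.val = 5 := by omega
      simp only [f, h5, lt_irrefl, if_false]
      rw [show n - 1 - 5 = a by omega, hpa]
      exact hb6.symm
  have hfp : ∀ i : Fin n, 5 ≤ i.val → f i = p (n - 1 - i.val) :=
    fun i hi => if_neg (by omega)
  have hfd : ∀ i : Fin n, 5 ≤ i.val → G.dist v (f i) = n - 1 - i.val := by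
    intro i hi
    rw [hfp i hi, (hp _ (by omega)).2]
  have hfd' : ∀ i : Fin n, i.val < 5 → a < G.dist v (f i) := by
    intro i hi
    rw [hf5 i hi.le, hdist _ (by omega)]
    omega
  have hfinj : Function.Injective f := by
    intro i j hij
    have hi := i.2
    have hj := j.2
    rcases Nat.lt_or_ge i.val 5 with h1 | h1 <;> rcases Nat.lt_or_ge j.val 5 with h2 | h2
    · rw [hf5 i h1.le, hf5 j h2.le] at hij
      have := hb.injOn (by omega) (by omega) hij
      exact Fin.ext (by omega)
    · have h3 := hfd' i h1
      rw [hij, hfd j h2] at h3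
      omega
    · have h3 := hfd' j h2
      rw [← hij, hfd i h1] at h3
      omega
    · have h3 := hfd i h1
      rw [hij, hfd j h2] at h3
      exact Fin.ext (by omega)
  have hfbij : Function.Bijective f :=
    (Fintype.bijective_iff_injective_and_card _).mpr ⟨hfinj, by simp [hn]⟩
  refine nonempty_iso_of_bijective hfbij ?_
    (by rw [hE]; exact le_ncard_edgeSet_lollipop (by omega) (by omega))
  have key : ∀ i j : Fin n, (i.val + 1 = j.val ∨ i.val = 0 ∧ j.val = 6 - 1) →
      G.Adj (f i) (f j) := by
    rintro i j (h | ⟨h0, h1⟩)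
    · have hj := j.2
      rcases Nat.lt_or_ge i.val 5 with h5 | h5
      · rw [hf5 i h5.le, hf5 j (by omega), ← h]
        exact hb.adj _
      · rw [hfp i h5, hfp j (by omega),
          show n - 1 - i.val = n - 1 - j.val + 1 by omega]
        exact hpadj _ (by omega)
    · rw [hf5 i (by omega), hf5 j (by omega), h0, h1]
      change G.Adj (b 1) (b 6)
      rw [hb6]
      exact (hb.adj 0).symm
  intro i j hij
  rw [lollipop, fromRel_adj] at hij
  rcases hij.2 with h | h
  · exact key i j h
  · exact (key j i h).symm

lemma IsCycleParam.three_mul_sum_dist_le (hc : IsCycleParam G r c) (hr : 6 ≤ r) (hre : Even r)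
    (hG : G.Connected) (hE : G.edgeSet.ncard = Fintype.card V) :
    3 * ∑ x, ∑ y, G.dist x y + 37 * Fintype.card V ≤ Fintype.card V ^ 3 + 168 ∧
      (3 * ∑ x, ∑ y, G.dist x y + 37 * Fintype.card V = Fintype.card V ^ 3 + 168 →
        Nonempty (G ≃g lollipop (Fintype.card V) 6) ∨
          Fintype.card V = 8 ∧ Nonempty (G ≃g lollipop 8 8)) := by
  obtain ⟨n, hn⟩ : ∃ n, Fintype.card V = n := ⟨_, rfl⟩
  induction n generalizing V with
  | zero => exact absurd (Fintype.card_pos_iff.mpr ⟨c 0⟩) (by omega)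
  | succ n ih =>
    rcases hc.exists_leaf_or_surjective (by omega) hG hE with ⟨w, u, hw⟩ | ⟨hsurj, -⟩
    · obtain ⟨hG', hE', hcard⟩ := connected_and_ncard_edgeSet_induce_compl_leaf hG hE hw
      have h1 := (ih (hc.induce (s := {w}ᶜ) (hc.ne_leaf (by omega) hw)) hG' hE' (by omega)).1
      obtain ⟨h2, h3⟩ := hc.two_mul_transmission_le hr hre hG hE w
      rw [sum_dist_leaf hG hw hG']
      rw [show Fintype.card ({w}ᶜ : Set V) = n by omega] at h1
      rw [hn] at h2 h3 ⊢
      rw [Nat.add_sub_cancel] at h2 h3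
      refine ⟨by nlinarith, fun h => Or.inl (h3 ?_)⟩
      nlinarith
    · obtain ⟨hcr, hiso⟩ := hc.nonempty_iso_lollipop (by omega) hsurj hE
      have h4 := hc.four_mul_sum_dist (by omega) hre hG hE hsurj
      rw [hcr]
      have hsplit : r = 6 ∨ r = 8 ∨ 10 ≤ r := by
        obtain ⟨m, rfl⟩ := hre
        omega
      rcases hsplit with rfl | rfl | h10
      · exact ⟨by omega, fun _ => Or.inl hiso⟩
      · exact ⟨by omega, fun _ => Or.inr ⟨rfl, hiso⟩⟩
      · have hlt : 148 * r < r ^ 3 + 672 := by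
          obtain ⟨s, rfl⟩ := Nat.exists_eq_add_of_le h10
          ring_nf
          omega
        exact ⟨by omega, fun h => by omega⟩

end Unicyclic

lemma exists_isCycleParam_girth {V : Type*} {G : SimpleGraph V} (h : G.girth ≠ 0) :
    ∃ c, IsCycleParam G G.girth c := by
  obtain ⟨a, w, hw, hlen⟩ := exists_girth_eq_length.mpr (mt girth_eq_zero.mpr h)
  have hpos : 0 < w.length := by omega
  rw [hlen]
  refine ⟨fun i => w.getVert (i % w.length), ⟨fun i => ?_, fun i => by simp, fun i j hij => ?_⟩⟩
  · have hlt := Nat.mod_lt i hpos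
    have hadj := w.adj_getVert_succ hlt
    rw [← Nat.mod_add_mod i]
    rcases Nat.lt_or_ge (i % w.length + 1) w.length with h1 | h1
    · rwa [Nat.mod_eq_of_lt h1]
    · rw [show i % w.length + 1 = w.length by omega, Walk.getVert_length] at hadj
      rwa [show i % w.length + 1 = w.length by omega, Nat.mod_self, Walk.getVert_zero]
  · have h1 := Nat.mod_lt i hpos
    have h2 := Nat.mod_lt j hpos
    exact hw.getVert_injOn' (by simp; omega) (by simp; omega) hij

/-- An `n`-vertex unicyclic graph with even girth `r ≥ 6` has Wiener
index at most `(n³ - 37n + 168)/6`, with equality iff it is `L_{n,6}` when `n ≠ 8`, and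
iff it is `L_{8,6}` or `L_{8,8}` when `n = 8`. -/
theorem wiener_unicyclic_even_girth_ge_six
    {V : Type*} [Fintype V] (G : SimpleGraph V) (n r : ℕ)
    (hcard : Fintype.card V = n)
    (hconn : G.Connected) (huni : G.edgeSet.ncard = n)
    (hgirth : G.girth = (r : ℕ∞)) (hr : 6 ≤ r) (hre : Even r) :
    wienerIndex G ≤ ((n : ℚ) ^ 3 - 37 * n + 168) / 6 ∧
    (wienerIndex G = ((n : ℚ) ^ 3 - 37 * n + 168) / 6 ↔
      (n ≠ 8 ∧ Nonempty (G ≃g lollipop n 6)) ∨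
      (n = 8 ∧ (Nonempty (G ≃g lollipop 8 6) ∨ Nonempty (G ≃g lollipop 8 8)))) := by
  have hr' : G.girth = r := by exact_mod_cast hgirth
  obtain ⟨c, hc⟩ := exists_isCycleParam_girth (G := G) (by omega)
  rw [hr'] at hc
  subst hcard
  obtain ⟨hle, heq⟩ := hc.three_mul_sum_dist_le hr hre hconn huni
  have hW : wienerIndex G = ((∑ x, ∑ y, G.dist x y : ℕ) : ℚ) / 2 := by
    simp [wienerIndex]
  have hn6 : Fintype.card V ≥ 6 := by
    have hinj : Function.Injective (fun i : Fin r => c i) :=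
      fun i j hij => Fin.ext (hc.injOn i.2 j.2 hij)
    have := Fintype.card_le_of_injective _ hinj
    rw [Fintype.card_fin] at this
    omega
  generalize Fintype.card V = n at *
  have hWiff : wienerIndex G = ((n : ℚ) ^ 3 - 37 * n + 168) / 6 ↔
      3 * ∑ x, ∑ y, G.dist x y + 37 * n = n ^ 3 + 168 := by
    rw [hW, ← Nat.cast_inj (R := ℚ)]
    generalize (∑ x, ∑ y, G.dist x y) = S
    push_cast
    constructor <;> intro h <;> linarith
  refine ⟨?_, ?_⟩
  · rw [hW]
    have : ((3 * ∑ x, ∑ y, G.dist x y + 37 * n : ℕ) : ℚ) ≤ ((n ^ 3 + 168 : ℕ) : ℚ) :=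
      Nat.cast_le.mpr hle
    generalize (∑ x, ∑ y, G.dist x y) = S at *
    push_cast at this
    linarith
  · rw [hWiff]
    have hsix : Nonempty (G ≃g lollipop n 6) →
        3 * ∑ x, ∑ y, G.dist x y + 37 * n = n ^ 3 + 168 := by
      rintro ⟨e⟩
      have h1 := sum_chordDist_le hconn e
      have h2 := three_mul_sum_sum_chordDist_six hn6
      omega
    constructor
    · intro h
      rcases heq h with h6 | ⟨rfl, h8⟩
      · by_cases hn : n = 8
        · subst hn
          exact Or.inr ⟨rfl, Or.inl h6⟩
        · exact Or.inl ⟨hn, h6⟩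
      · exact Or.inr ⟨rfl, Or.inr h8⟩
    · rintro (⟨-, h6⟩ | ⟨rfl, h6 | ⟨⟨e⟩⟩⟩)
      · exact hsix h6
      · exact hsix h6
      · have h1 := sum_chordDist_le hconn e
        have h2 : ∑ i ∈ Finset.range 8, ∑ j ∈ Finset.range 8, chordDist 8 i j = 128 := by decide
        omega
end
end
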